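/- arXiv:2402.12068 — 3 statements merged into one kernel-verified Lean document; each statement's English description precedes it below -/
import Mathlib

section
/- Every discrete first-price auction with iid priors has an exact (0-approximate) mixed Bayes–Nash equilibrium which is symmetric (all bidders use the same strategy), monotone, and non-overbidding. -/
open Finset

/-- Ex-post utility of bidder `i` with value `v` under bid profile `bb`:
`(v - bb i)/|W|` if `i` is among the highest bidders `W` (uniform tie-breaking), else `0`. -/
noncomputable def exPost (n : ℕ) (i : Fin n) (v : ℝ) (bb : Fin n → ℝ) : ℝ :=
  if ∀ k, bb k ≤ bb i then
    (v - bb i) / ((Finset.univ.filter (fun j : Fin n => ∀ k, bb k ≤ bb j)).card : ℝ)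
  else 0

/-- Interim utility of bidder `i` bidding `b` with value `v`, when each opponent `j`'s
value is drawn from the prior `f i j` on `V j` and `j` then bids according to the mixed
strategy `β j`. -/
noncomputable def interim (n : ℕ) (V : Fin n → Finset ℝ) (B : Finset ℝ)
    (f : Fin n → Fin n → ℝ → ℝ) (β : Fin n → ℝ → ℝ → ℝ)
    (i : Fin n) (b : ℝ) (v : ℝ) : ℝ :=
  ∑ bb ∈ Fintype.piFinset (fun j : Fin n => if j = i then ({b} : Finset ℝ) else B),
    (∏ j ∈ Finset.univ.erase i, ∑ w ∈ V j, f i j w * β j w (bb j)) * exPost n i v bb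

/-- Interim utility of bidder `i` bidding a mixed bid `γ ∈ Δ(B)` with value `v`. -/
noncomputable def interimMix (n : ℕ) (V : Fin n → Finset ℝ) (B : Finset ℝ)
    (f : Fin n → Fin n → ℝ → ℝ) (β : Fin n → ℝ → ℝ → ℝ)
    (i : Fin n) (γ : ℝ → ℝ) (v : ℝ) : ℝ :=
  ∑ b ∈ B, γ b * interim n V B f β i b v

/-- `γ` is a probability distribution on the finite bid set `B`. -/
def IsDist (B : Finset ℝ) (γ : ℝ → ℝ) : Prop :=
  (∀ b, 0 ≤ γ b) ∧ ∑ b ∈ B, γ b = 1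

/-- `β` is a mixed-strategy profile: each `β i v` is a distribution on `B` for `v ∈ V i`. -/
def IsMixedProfile (n : ℕ) (V : Fin n → Finset ℝ) (B : Finset ℝ)
    (β : Fin n → ℝ → ℝ → ℝ) : Prop :=
  ∀ i : Fin n, ∀ v ∈ V i, IsDist B (β i v)

/-- No bidder ever puts positive probability on a bid above her value. -/
def NonOverbidding (n : ℕ) (V : Fin n → Finset ℝ) (B : Finset ℝ)
    (β : Fin n → ℝ → ℝ → ℝ) : Prop :=
  ∀ i : Fin n, ∀ v ∈ V i, ∀ b ∈ B, v < b → β i v b = 0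

/-- A mixed strategy is monotone: every bid in the support at a lower value is at most
every bid in the support at a higher value. -/
def MonotoneStrat (V B : Finset ℝ) (β0 : ℝ → ℝ → ℝ) : Prop :=
  ∀ v ∈ V, ∀ v' ∈ V, v < v' → ∀ b ∈ B, ∀ b' ∈ B, 0 < β0 v b → 0 < β0 v' b' → b ≤ b'

/-- Well-formedness of the subjective priors: for `i ≠ j`, `f i j` is a pmf on `V j`. -/
def IsPrior (n : ℕ) (V : Fin n → Finset ℝ) (f : Fin n → Fin n → ℝ → ℝ) : Prop :=
  ∀ i j : Fin n, i ≠ j →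
    (∀ v, 0 ≤ f i j v) ∧ (∀ v, v ∉ V j → f i j v = 0) ∧ ∑ v ∈ V j, f i j v = 1

/-- `β` is an ε-approximate mixed Bayes–Nash equilibrium. -/
def MBNE (n : ℕ) (V : Fin n → Finset ℝ) (B : Finset ℝ)
    (f : Fin n → Fin n → ℝ → ℝ) (β : Fin n → ℝ → ℝ → ℝ) (ε : ℝ) : Prop :=
  ∀ i : Fin n, ∀ v ∈ V i, ∀ γ : ℝ → ℝ, IsDist B γ →
    interimMix n V B f β i (β i v) v ≥ interimMix n V B f β i γ v - ε

/-- `β` is an ε-well-supported mixed Bayes–Nash equilibrium. -/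
def WSMBNE (n : ℕ) (V : Fin n → Finset ℝ) (B : Finset ℝ)
    (f : Fin n → Fin n → ℝ → ℝ) (β : Fin n → ℝ → ℝ → ℝ) (ε : ℝ) : Prop :=
  ∀ i : Fin n, ∀ v ∈ V i, ∀ b ∈ B, 0 < β i v b → ∀ γ : ℝ → ℝ, IsDist B γ →
    interim n V B f β i b v ≥ interimMix n V B f β i γ v - ε

section Miranda

/-- The vertices of the lattice path that starts at `x` and takes unit steps in the directions
`l`. -/
def pathVertices {ι : Type*} [DecidableEq ι] (x : ι → ℕ) : List ι → List (ι → ℕ)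
  | [] => [x]
  | i :: l => x :: pathVertices (Function.update x i (x i + 1)) l

/-- The cup product of the coboundaries of the functions in the first list, evaluated on the
simplex spanned by the second list. -/
def cupCoboundary {X : Type*} : List (X → ZMod 2) → List X → ZMod 2
  | [], _ => 1
  | s :: S, x :: y :: L => (s y + s x) * cupCoboundary S (y :: L)
  | _ :: _, _ => 0

/-- Exchange the entries in positions `j` and `j + 1`. -/
def swapAdjacent {α : Type*} : ℕ → List α → List α
  | 0, a :: b :: l => b :: a :: l
  | j + 1, a :: l => a :: swapAdjacent j l
  | _, l => l

variable {ι : Type*} [DecidableEq ι]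

lemma pathVertices_eq_cons (x : ι → ℕ) (l : List ι) :
    ∃ L, pathVertices x l = x :: L := by
  cases l <;> simp [pathVertices]

lemma length_pathVertices (x : ι → ℕ) (l : List ι) :
    (pathVertices x l).length = l.length + 1 := by
  induction l generalizing x with
  | nil => rfl
  | cons i l ih => simp [pathVertices, ih]

lemma eraseIdx_pathVertices_length (x : ι → ℕ) (l : List ι) (i : ι) :
    (pathVertices x (l ++ [i])).eraseIdx (l.length + 1) = pathVertices x l := by
  induction l generalizing x with
  | nil => simp [pathVertices]
  | cons a l ih => simp [pathVertices, ih]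

lemma pathVertices_apply_of_notMem {x : ι → ℕ} {l : List ι} {i : ι} (hi : i ∉ l) :
    ∀ y ∈ pathVertices x l, y i = x i := by
  induction l generalizing x with
  | nil => simp [pathVertices]
  | cons a l ih =>
    simp only [List.mem_cons, not_or] at hi
    intro y hy
    simp only [pathVertices, List.mem_cons] at hy
    rcases hy with rfl | hy
    · rfl
    · rw [ih hi.2 y hy, Function.update_of_ne hi.1]

lemma pathVertices_bounds {x : ι → ℕ} {l : List ι} (hl : l.Nodup) :
    ∀ y ∈ pathVertices x l, ∀ i, x i ≤ y i ∧ y i ≤ x i + 1 := by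
  induction l generalizing x with
  | nil => simp [pathVertices]
  | cons a l ih =>
    intro y hy i
    simp only [pathVertices, List.mem_cons] at hy
    rw [List.nodup_cons] at hl
    rcases hy with rfl | hy
    · simp
    · by_cases hia : i = a
      · subst hia
        rw [pathVertices_apply_of_notMem hl.1 y hy]
        simp
      · simpa [Function.update_of_ne hia] using ih hl.2 y hy i

lemma swapAdjacent_perm {α : Type*} (j : ℕ) (l : List α) : (swapAdjacent j l).Perm l := by
  induction j generalizing l with
  | zero =>
    match l with
    | [] => rfl
    | [a] => rfl
    | a :: b :: l => exact List.Perm.swap _ _ _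
  | succ j ih =>
    match l with
    | [] => rfl
    | a :: l => exact (ih l).cons a

lemma swapAdjacent_swapAdjacent {α : Type*} (j : ℕ) (l : List α) :
    swapAdjacent j (swapAdjacent j l) = l := by
  induction j generalizing l with
  | zero =>
    match l with
    | [] => rfl
    | [a] => rfl
    | a :: b :: l => rfl
  | succ j ih =>
    match l with
    | [] => rfl
    | a :: l => simp [swapAdjacent, ih]

lemma swapAdjacent_ne_self {α : Type*} {j : ℕ} {l : List α} (hl : l.Nodup)
    (hj : j + 1 < l.length) : swapAdjacent j l ≠ l := by
  induction j generalizing l with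
  | zero =>
    match l with
    | [] => simp at hj
    | [a] => simp at hj
    | a :: b :: l =>
      simp only [List.nodup_cons, List.mem_cons, not_or] at hl
      simp only [swapAdjacent, ne_eq, List.cons.injEq, not_and]
      intro h
      exact absurd h.symm hl.1.1
  | succ j ih =>
    match l with
    | [] => simp at hj
    | a :: l =>
      simp only [swapAdjacent, ne_eq, List.cons.injEq, true_and]
      exact ih (List.nodup_cons.1 hl).2 (by simpa using hj)

lemma eraseIdx_pathVertices_swapAdjacent (x : ι → ℕ) (j : ℕ) (l : List ι) :
    (pathVertices x (swapAdjacent j l)).eraseIdx (j + 1) =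
      (pathVertices x l).eraseIdx (j + 1) := by
  induction j generalizing l x with
  | zero =>
    match l with
    | [] => rfl
    | [a] => rfl
    | a :: b :: l =>
      simp only [swapAdjacent, pathVertices, zero_add, List.eraseIdx_cons_succ,
        List.eraseIdx_cons_zero, List.cons.injEq, true_and]
      congr 1
      by_cases h : a = b
      · subst h; rfl
      · rw [Function.update_of_ne h, Function.update_of_ne (Ne.symm h), Function.update_comm h]
  | succ j ih =>
    match l with
    | [] => rfl
    | a :: l => simpa [swapAdjacent, pathVertices] using ih _ l

lemma cupCoboundary_eq_zero {X : Type*} {S : List (X → ZMod 2)} {L : List X} {s : X → ZMod 2}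
    (hs : s ∈ S) (c : ZMod 2) (hc : ∀ y ∈ L, s y = c) : cupCoboundary S L = 0 := by
  induction S generalizing L with
  | nil => simp at hs
  | cons s' S ih =>
    match L with
    | [] => rfl
    | [a] => rfl
    | a :: b :: L =>
      simp only [cupCoboundary]
      rcases List.mem_cons.1 hs with rfl | hs
      · rw [hc a (by simp), hc b (by simp), CharTwo.add_self_eq_zero, zero_mul]
      · rw [ih hs (fun y hy => hc y (List.mem_cons_of_mem _ hy)), mul_zero]

/-- A cup product of coboundaries is a cocycle. -/
lemma sum_cupCoboundary_eraseIdx {X : Type*} (S : List (X → ZMod 2)) (L : List X)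
    (hL : L.length = S.length + 2) :
    ∑ j ∈ range (S.length + 2), cupCoboundary S (L.eraseIdx j) = 0 := by
  induction S generalizing L with
  | nil =>
    simp only [cupCoboundary, List.length_nil]
    decide
  | cons s S ih =>
    match L with
    | [] => simp at hL
    | [a] => simp at hL
    | [a, b] => simp at hL
    | a :: b :: c :: L =>
      have h := ih (b :: c :: L) (by simpa using hL)
      rw [Finset.sum_range_succ'] at h
      rw [List.length_cons, Finset.sum_range_succ', Finset.sum_range_succ']
      simp only [List.eraseIdx_cons_succ, List.eraseIdx_cons_zero, cupCoboundary,
        ← Finset.mul_sum] at h ⊢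
      have h2 := eq_neg_of_add_eq_zero_left h
      rw [CharTwo.neg_eq] at h2
      rw [h2]
      have e : ∀ p q r R : ZMod 2, (q + p) * R + (r + p) * R + (r + q) * R = 0 := by decide
      exact e _ _ _ _

/-- The enumerations of a finite set. -/
noncomputable def orderings (D : Finset ι) : Finset (List ι) := D.toList.permutations.toFinset

lemma mem_orderings {D : Finset ι} {l : List ι} : l ∈ orderings D ↔ l.Perm D.toList := by
  simp [orderings]

lemma orderings_nodup {D : Finset ι} {l : List ι} (h : l ∈ orderings D) : l.Nodup :=
  (mem_orderings.1 h).nodup_iff.2 D.nodup_toList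

lemma orderings_mem {D : Finset ι} {l : List ι} (h : l ∈ orderings D) {i : ι} :
    i ∈ l ↔ i ∈ D := by
  rw [(mem_orderings.1 h).mem_iff, Finset.mem_toList]

lemma orderings_length {D : Finset ι} {l : List ι} (h : l ∈ orderings D) :
    l.length = D.card := by
  rw [(mem_orderings.1 h).length_eq, Finset.length_toList]

lemma mem_orderings_iff {D : Finset ι} {l : List ι} :
    l ∈ orderings D ↔ l.Nodup ∧ ∀ i, i ∈ l ↔ i ∈ D := by
  refine ⟨fun h => ⟨orderings_nodup h, fun i => orderings_mem h⟩, fun h => ?_⟩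
  rw [mem_orderings, List.perm_ext_iff_of_nodup h.1 D.nodup_toList]
  simpa using h.2

lemma sum_orderings_cons {M : Type*} [AddCommMonoid M] {D : Finset ι} (hD : D.Nonempty)
    (F : List ι → M) :
    ∑ l ∈ orderings D, F l = ∑ i ∈ D, ∑ l ∈ orderings (D.erase i), F (i :: l) := by
  rw [Finset.sum_sigma']
  symm
  refine Finset.sum_bij (fun p _ => p.1 :: p.2) ?_ ?_ ?_ ?_
  · rintro ⟨i, l⟩ h
    simp only [Finset.mem_sigma, mem_orderings_iff, Finset.mem_erase] at h
    simp only [mem_orderings_iff, List.nodup_cons, List.mem_cons]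
    refine ⟨⟨by simp [h.2.2], h.2.1⟩, fun j => ?_⟩
    rw [h.2.2]
    by_cases hj : j = i
    · simp [hj, h.1]
    · simp [hj]
  · rintro ⟨i, l⟩ _ ⟨i', l'⟩ _ h
    simp only [List.cons.injEq] at h
    obtain ⟨rfl, rfl⟩ := h
    rfl
  · intro l hl
    rw [mem_orderings_iff] at hl
    match l with
    | [] =>
      obtain ⟨i, hi⟩ := hD
      simpa using (hl.2 i).2 hi
    | i :: l =>
      refine ⟨⟨i, l⟩, ?_, rfl⟩
      obtain ⟨h1, h2⟩ := hl
      rw [List.nodup_cons] at h1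
      simp only [Finset.mem_sigma, mem_orderings_iff, Finset.mem_erase]
      refine ⟨(h2 i).1 (by simp), h1.2, fun j => ?_⟩
      rw [← h2 j, List.mem_cons]
      constructor
      · intro hj
        exact ⟨fun e => h1.1 (e ▸ hj), Or.inr hj⟩
      · rintro ⟨hj, hj' | hj'⟩
        · exact absurd hj' hj
        · exact hj'
  · intros; rfl

lemma sum_orderings_reverse {M : Type*} [AddCommMonoid M] (D : Finset ι) (F : List ι → M) :
    ∑ l ∈ orderings D, F l.reverse = ∑ l ∈ orderings D, F l := by
  refine Finset.sum_nbij' List.reverse List.reverse ?_ ?_ ?_ ?_ ?_ <;>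
    simp +contextual [mem_orderings_iff]

lemma sum_orderings_concat {M : Type*} [AddCommMonoid M] {D : Finset ι} (hD : D.Nonempty)
    (F : List ι → M) :
    ∑ l ∈ orderings D, F l = ∑ i ∈ D, ∑ l ∈ orderings (D.erase i), F (l ++ [i]) := by
  rw [← sum_orderings_reverse, sum_orderings_cons hD]
  refine Finset.sum_congr rfl fun i _ => ?_
  rw [← sum_orderings_reverse]
  simp

lemma sum_orderings_swapAdjacent {D : Finset ι} {j : ℕ} (hj : j + 1 < D.card)
    (F : List ι → ZMod 2) (hF : ∀ l, F (swapAdjacent j l) = F l) :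
    ∑ l ∈ orderings D, F l = 0 := by
  refine Finset.sum_involution (fun l _ => swapAdjacent j l) ?_ ?_ ?_ ?_
  · intro l _
    rw [hF, CharTwo.add_self_eq_zero]
  · intro l hl _
    exact swapAdjacent_ne_self (orderings_nodup hl) (by rwa [orderings_length hl])
  · intro l hl
    rw [mem_orderings] at hl ⊢
    exact (swapAdjacent_perm j l).trans hl
  · intro l _
    exact swapAdjacent_swapAdjacent j l

lemma sum_cupCoboundary_tail (S : List ((ι → ℕ) → ZMod 2)) {D : Finset ι}
    (hD : D.card = S.length + 1) (x : ι → ℕ) :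
    ∑ i ∈ D, ∑ l ∈ orderings (D.erase i),
        cupCoboundary S (pathVertices (Function.update x i (x i + 1)) l) =
      ∑ i ∈ D, ∑ l ∈ orderings (D.erase i), cupCoboundary S (pathVertices x l) := by
  have hne : D.Nonempty := by rw [← Finset.card_pos]; omega
  have h : ∑ l ∈ orderings D, ∑ j ∈ range (S.length + 2),
      cupCoboundary S ((pathVertices x l).eraseIdx j) = 0 := by
    refine Finset.sum_eq_zero fun l hl => sum_cupCoboundary_eraseIdx _ _ ?_
    rw [length_pathVertices, orderings_length hl, hD]
  rw [Finset.sum_comm, Finset.sum_range_succ', Finset.sum_range_succ, Finset.sum_eq_zero,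
    zero_add, sum_orderings_concat hne, sum_orderings_cons hne] at h
  · rw [← CharTwo.add_eq_zero, add_comm]
    convert h using 1
    congr 1
    refine Finset.sum_congr rfl fun i hi => Finset.sum_congr rfl fun l hl => ?_
    rw [← eraseIdx_pathVertices_length x l i, orderings_length hl, Finset.card_erase_of_mem hi,
      hD, Nat.add_sub_cancel]
  · intro j hj
    rw [Finset.mem_range] at hj
    refine sum_orderings_swapAdjacent (j := j) (by omega) _ fun l => ?_
    rw [eraseIdx_pathVertices_swapAdjacent]

variable [Fintype ι]

/-- The lower corners of the cells of the face of the grid `{0, …, N}` on which all coordinates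
outside `D` equal `N`. -/
def gridFace (N : ℕ) (D : Finset ι) : Finset (ι → ℕ) :=
  Fintype.piFinset fun i => if i ∈ D then range N else {N}

lemma mem_gridFace {N : ℕ} {D : Finset ι} {x : ι → ℕ} :
    x ∈ gridFace N D ↔ ∀ i, if i ∈ D then x i < N else x i = N := by
  simp only [gridFace, Fintype.mem_piFinset]
  refine forall_congr' fun i => ?_
  split_ifs <;> simp

lemma sum_gridFace {M : Type*} [AddCommMonoid M] {N : ℕ} {D : Finset ι} {i : ι} (hi : i ∈ D)
    (g : (ι → ℕ) → M) :
    ∑ x ∈ gridFace N D, g x =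
      ∑ x ∈ gridFace N (D.erase i), ∑ t ∈ range N, g (Function.update x i t) := by
  rw [← Finset.sum_product']
  refine Finset.sum_nbij' (fun x => (Function.update x i N, x i))
    (fun p => Function.update p.1 i p.2) ?_ ?_ ?_ ?_ ?_
  · intro x hx
    rw [mem_gridFace] at hx
    have hxi := hx i
    simp only [hi, if_true] at hxi
    simp only [Finset.mem_product, mem_gridFace, Finset.mem_range, hxi, and_true]
    intro j
    by_cases hj : j = i
    · simp [hj]
    · simpa [hj] using hx j
  · rintro ⟨x, t⟩ hx
    simp only [Finset.mem_product, mem_gridFace, Finset.mem_range] at hx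
    rw [mem_gridFace]
    intro j
    by_cases hj : j = i
    · simpa [hj, hi] using hx.2
    · simpa [hj] using hx.1 j
  · intro x _
    simp
  · rintro ⟨x, t⟩ hx
    simp only [Finset.mem_product, mem_gridFace] at hx
    have := hx.1 i
    simp only [Finset.mem_erase, ne_eq, not_true_eq_false, false_and, if_false] at this
    simp [← this]
  · intro x _
    simp

lemma sum_range_succ_add_self (N : ℕ) (h : ℕ → ZMod 2) :
    ∑ t ∈ range N, (h (t + 1) + h t) = h N + h 0 := by
  have := Finset.sum_range_sub h N
  simpa only [CharTwo.sub_eq_add] using this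

/-- The total cup product of the coboundaries over the Kuhn triangulation of the cube is `1`. -/
lemma sum_gridFace_cupCoboundary (N : ℕ) (s : ι → (ι → ℕ) → ZMod 2)
    (h0 : ∀ k x, x k = 0 → s k x = 0) (h1 : ∀ k x, x k = N → s k x = 1)
    (K : List ι) (hK : K.Nodup) :
    ∑ x ∈ gridFace N K.toFinset, ∑ l ∈ orderings K.toFinset,
      cupCoboundary (K.map s) (pathVertices x l) = 1 := by
  induction K with
  | nil =>
    have e1 : gridFace N (∅ : Finset ι) = {fun _ => N} := by
      ext x; simp [mem_gridFace, funext_iff]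
    have e2 : orderings (∅ : Finset ι) = {[]} := by
      ext x; simp [mem_orderings]
    simp [e1, e2, cupCoboundary]
  | cons k K ih =>
    rw [List.nodup_cons] at hK
    set D := (k :: K).toFinset with hD
    have hkD : k ∈ D := by simp [hD]
    have hDk : D.erase k = K.toFinset := by
      ext j
      simp only [hD, List.toFinset_cons, Finset.mem_erase, Finset.mem_insert, List.mem_toFinset]
      constructor
      · rintro ⟨h, h' | h'⟩
        · exact absurd h' h
        · exact h'
      · intro h
        exact ⟨fun e => hK.1 (e ▸ h), Or.inr h⟩
    have hcard : D.card = (K.map s).length + 1 := by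
      rw [hD, List.toFinset_card_of_nodup (List.nodup_cons.2 hK)]; simp
    set Q : (ι → ℕ) → List ι → ZMod 2 :=
      fun x l => s k x * cupCoboundary (K.map s) (pathVertices x l) with hQ
    have hx : ∀ x, ∑ l ∈ orderings D, cupCoboundary ((k :: K).map s) (pathVertices x l) =
        ∑ i ∈ D, ∑ l ∈ orderings (D.erase i), (Q (Function.update x i (x i + 1)) l + Q x l) := by
      intro x
      have e := congrArg (s k x * ·) (sum_cupCoboundary_tail (K.map s) hcard x)
      simp only [Finset.mul_sum] at e
      rw [sum_orderings_cons ⟨k, hkD⟩]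
      simp only [Finset.sum_add_distrib, hQ]
      rw [← e]
      simp only [← Finset.sum_add_distrib]
      refine Finset.sum_congr rfl fun i _ => Finset.sum_congr rfl fun l _ => ?_
      obtain ⟨L, hL⟩ := pathVertices_eq_cons (Function.update x i (x i + 1)) l
      simp only [pathVertices, List.map_cons, hL, cupCoboundary, add_mul]
    have hQ0 : ∀ x i, i ∈ D → i ≠ k → x i = 0 ∨ x i = N → ∀ l ∈ orderings (D.erase i),
        Q x l = 0 := by
      intro x i hi hik hxi l hl
      have hil : i ∉ l := by rw [orderings_mem hl]; simp
      have hiK : i ∈ K := by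
        have : i ∈ D.erase k := Finset.mem_erase.2 ⟨hik, hi⟩
        rw [hDk] at this
        simpa using this
      have hconst := pathVertices_apply_of_notMem (x := x) hil
      simp only [hQ]
      rcases hxi with hxi | hxi
      · rw [cupCoboundary_eq_zero (List.mem_map_of_mem hiK) 0, mul_zero]
        exact fun y hy => h0 i y ((hconst y hy).trans hxi)
      · rw [cupCoboundary_eq_zero (List.mem_map_of_mem hiK) 1, mul_zero]
        exact fun y hy => h1 i y ((hconst y hy).trans hxi)
    have hi : ∀ i ∈ D, ∑ x ∈ gridFace N D, ∑ l ∈ orderings (D.erase i),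
        (Q (Function.update x i (x i + 1)) l + Q x l) =
        ∑ x ∈ gridFace N (D.erase i), ∑ l ∈ orderings (D.erase i),
          (Q x l + Q (Function.update x i 0) l) := by
      intro i hi
      rw [sum_gridFace hi]
      refine Finset.sum_congr rfl fun x hx => ?_
      rw [Finset.sum_comm]
      refine Finset.sum_congr rfl fun l _ => ?_
      have hxi : x i = N := by simpa using mem_gridFace.1 hx i
      have := sum_range_succ_add_self N (fun t => Q (Function.update x i t) l)
      simp only [Function.update_idem, Function.update_self]
      rw [this, ← hxi, Function.update_eq_self]
    rw [Finset.sum_congr rfl fun x _ => hx x, Finset.sum_comm, Finset.sum_congr rfl hi,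
      Finset.sum_eq_single k, hDk, ← ih hK.2]
    · refine Finset.sum_congr rfl fun x hx => Finset.sum_congr rfl fun l _ => ?_
      have hxk : x k = N := by simpa [hK.1] using mem_gridFace.1 hx k
      simp only [hQ]
      rw [h1 k x hxk, h0 k (Function.update x k 0) (by simp)]
      simp
    · intro i hiD hik
      refine Finset.sum_eq_zero fun x hx => Finset.sum_eq_zero fun l hl => ?_
      have hxi : x i = N := by simpa using mem_gridFace.1 hx i
      rw [hQ0 x i hiD hik (Or.inr hxi) l hl,
        hQ0 (Function.update x i 0) i hiD hik (Or.inl (by simp)) l hl, add_zero]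
    · exact fun h => absurd hkD h

/-- A discrete Poincaré–Miranda theorem. -/
lemma exists_cell_of_labelling (N : ℕ) (s : ι → (ι → ℕ) → ZMod 2)
    (h0 : ∀ k x, x k = 0 → s k x = 0) (h1 : ∀ k x, x k = N → s k x = 1) :
    ∃ x : ι → ℕ, (∀ i, x i < N) ∧ ∀ k, ∀ c : ZMod 2,
      ∃ y, (∀ i, x i ≤ y i ∧ y i ≤ x i + 1) ∧ s k y = c := by
  have h := sum_gridFace_cupCoboundary N s h0 h1 (Finset.univ : Finset ι).toList
    (Finset.nodup_toList _)
  rw [Finset.toList_toFinset] at h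
  obtain ⟨x, hx, h⟩ := Finset.exists_ne_zero_of_sum_ne_zero (h.trans_ne one_ne_zero)
  obtain ⟨l, hl, h⟩ := Finset.exists_ne_zero_of_sum_ne_zero h
  refine ⟨x, fun i => by simpa using mem_gridFace.1 hx i, fun k c => ?_⟩
  by_contra! hc
  refine h (cupCoboundary_eq_zero (s := s k) (by simp) (c + 1) fun y hy => ?_)
  have := hc y (pathVertices_bounds (orderings_nodup hl) y hy)
  have e : ∀ a b : ZMod 2, a ≠ b → a = b + 1 := by decide
  exact e _ _ this

/-- A Poincaré–Miranda theorem for coverings of a cube. -/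
lemma exists_mem_closure_of_cover {L : ℝ} (hL : 0 < L) (P Q : ι → Set (ι → ℝ))
    (hPQ : ∀ k t, t ∈ P k ∨ t ∈ Q k) (hP : ∀ k t, t k = 0 → t ∈ P k)
    (hQ : ∀ k t, t k = L → t ∈ Q k) :
    ∃ t : ι → ℝ, (∀ i, t i ∈ Set.Icc 0 L) ∧ ∀ k, t ∈ closure (P k) ∧ t ∈ closure (Q k) := by
  classical
  have key : ∀ n : ℕ, ∃ a : ι → ℝ, a ∈ Set.Icc (0 : ι → ℝ) (fun _ => L) ∧
      ∀ k, (∃ p ∈ P k, dist p a ≤ L / (n + 1 : ℕ)) ∧ ∃ q ∈ Q k, dist q a ≤ L / (n + 1 : ℕ) := by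
    intro n
    set N := n + 1 with hN
    have hNpos : (0 : ℝ) < N := by positivity
    set pt : (ι → ℕ) → ι → ℝ := fun x i => L * x i / N with hpt
    obtain ⟨x, hx, h⟩ := exists_cell_of_labelling N
      (fun k x => if x k = 0 then 0 else if x k = N then 1 else if pt x ∈ P k then 0 else 1)
      (fun k x h => by simp [h]) (fun k x h => by simp [h, hN])
    have hd : ∀ y : ι → ℕ, (∀ i, x i ≤ y i ∧ y i ≤ x i + 1) → dist (pt y) (pt x) ≤ L / N := by
      intro y hy
      rw [dist_pi_le_iff (by positivity)]
      intro i
      have h1 : (x i : ℝ) ≤ y i := by exact_mod_cast (hy i).1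
      have h2 : (y i : ℝ) ≤ x i + 1 := by exact_mod_cast (hy i).2
      simp only [hpt, Real.dist_eq]
      rw [← sub_div, ← mul_sub, abs_of_nonneg (by apply div_nonneg _ hNpos.le; nlinarith)]
      gcongr
      nlinarith
    refine ⟨pt x, ⟨fun i => by simp only [hpt, Pi.zero_apply]; positivity, fun i => ?_⟩,
      fun k => ⟨?_, ?_⟩⟩
    · simp only [hpt]
      rw [div_le_iff₀ hNpos]
      have : (x i : ℝ) ≤ N := by exact_mod_cast (hx i).le
      gcongr
    · obtain ⟨y, hy, hs⟩ := h k 0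
      refine ⟨pt y, ?_, hd y hy⟩
      split_ifs at hs with h1 h2 h3
      · exact hP k _ (by simp [hpt, h1])
      · exact absurd hs one_ne_zero
      · exact h3
      · exact absurd hs one_ne_zero
    · obtain ⟨y, hy, hs⟩ := h k 1
      refine ⟨pt y, ?_, hd y hy⟩
      split_ifs at hs with h1 h2 h3
      · exact absurd hs zero_ne_one
      · exact hQ k _ (by simp only [hpt, h2]; field_simp)
      · exact absurd hs zero_ne_one
      · exact (hPQ k _).resolve_left h3
  choose a ha h using key
  obtain ⟨t, ht, φ, hφ, hlim⟩ := isCompact_Icc.tendsto_subseq ha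
  have hzero : Filter.Tendsto (fun n => L / ((φ n + 1 : ℕ) : ℝ)) Filter.atTop (nhds 0) :=
    ((tendsto_const_div_atTop_nhds_zero_nat L).comp
      (Filter.tendsto_add_atTop_nat 1)).comp hφ.tendsto_atTop
  have hcl : ∀ S : Set (ι → ℝ), (∀ n, ∃ p ∈ S, dist p (a n) ≤ L / (n + 1 : ℕ)) →
      t ∈ closure S := by
    intro S hS
    choose p hpS hp using hS
    refine mem_closure_of_tendsto (f := fun n => p (φ n)) (b := Filter.atTop) ?_
      (Filter.Eventually.of_forall fun n => hpS _)
    refine tendsto_of_tendsto_of_dist hlim ?_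
    refine squeeze_zero (fun _ => dist_nonneg) (fun n => ?_) hzero
    rw [dist_comm]
    exact hp _
  exact ⟨t, fun i => ⟨ht.1 i, ht.2 i⟩, fun k => ⟨hcl _ fun n => (h n k).1, hcl _ fun n => (h n k).2⟩⟩

end Miranda

section Cuts

variable {ι : Type*}

/-- The running maximum of the cuts `t` over a finite set of bids. -/
noncomputable def maxCut (t : ι → ℝ) (S : Finset ι) : ℝ := S.fold max 0 t

lemma lt_maxCut {t : ι → ℝ} {S : Finset ι} {c : ℝ} (hc : 0 ≤ c) :
    c < maxCut t S ↔ ∃ i ∈ S, c < t i := by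
  rw [maxCut, Finset.lt_fold_max, or_iff_right hc.not_gt]

lemma le_maxCut {t : ι → ℝ} {S : Finset ι} {i : ι} (hi : i ∈ S) : t i ≤ maxCut t S :=
  (Finset.le_fold_max _).2 (Or.inr ⟨i, hi, le_rfl⟩)

lemma maxCut_nonneg (t : ι → ℝ) (S : Finset ι) : 0 ≤ maxCut t S :=
  (Finset.le_fold_max _).2 (Or.inl le_rfl)

lemma maxCut_le {t : ι → ℝ} {S : Finset ι} {c : ℝ} (hc : 0 ≤ c) (h : ∀ i, t i ≤ c) :
    maxCut t S ≤ c :=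
  (Finset.fold_max_le _).2 ⟨hc, fun i _ => h i⟩

lemma maxCut_mono (t : ι → ℝ) {S S' : Finset ι} (h : S ⊆ S') : maxCut t S ≤ maxCut t S' :=
  (Finset.fold_max_le _).2 ⟨maxCut_nonneg t S', fun _ hi => le_maxCut (h hi)⟩

variable [LinearOrder ι]

lemma continuous_maxCut (S : Finset ι) : Continuous fun t : ι → ℝ => maxCut t S := by
  induction S using Finset.induction_on with
  | empty => simpa [maxCut] using continuous_const
  | insert a S ha ih =>
    simp only [maxCut, Finset.fold_insert ha]
    exact (continuous_apply a).max ih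

/-- Below a cut, some bid at or below the cut is optimal among the bids that are not above the
value. -/
def PrefersBelow (bid : ι → ℝ) (h : ι → ℝ) (k : ι) (x : ℝ) : Prop :=
  ∀ j, k < j → bid j ≤ x → ∃ i, i ≤ k ∧ (x - bid j) * h j ≤ (x - bid i) * h i

/-- Above a cut, some bid above the cut is optimal among the bids that are not above the value. -/
def PrefersAbove (bid : ι → ℝ) (h : ι → ℝ) (k : ι) (x : ℝ) : Prop :=
  ∃ j, k < j ∧ bid j ≤ x ∧ ∀ i, i ≤ k → (x - bid i) * h i ≤ (x - bid j) * h j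

lemma prefersAbove_of_not_prefersBelow {bid h : ι → ℝ} {k : ι} {x : ℝ}
    (hn : ¬ PrefersBelow bid h k x) : PrefersAbove bid h k x := by
  simp only [PrefersBelow, not_forall, not_exists, not_and, not_le] at hn
  obtain ⟨j, hj, hx, hn⟩ := hn
  exact ⟨j, hj, hx, fun i hi => (hn i hi).le⟩

lemma PrefersBelow.anti {bid h : ι → ℝ} (hh : Monotone h) {k : ι} {x y : ℝ} (hyx : y ≤ x)
    (hx : PrefersBelow bid h k x) : PrefersBelow bid h k y := by
  intro j hj hy
  obtain ⟨i, hi, hle⟩ := hx j hj (hy.trans hyx)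
  refine ⟨i, hi, ?_⟩
  have := hh (hi.trans hj.le)
  nlinarith

lemma PrefersAbove.mono {bid h : ι → ℝ} (hh : Monotone h) {k : ι} {x y : ℝ} (hxy : x ≤ y)
    (hx : PrefersAbove bid h k x) : PrefersAbove bid h k y := by
  obtain ⟨j, hj, hle, hx⟩ := hx
  refine ⟨j, hj, hle.trans hxy, fun i hi => ?_⟩
  have := hh (hi.trans hj.le)
  have := hx i hi
  nlinarith

variable [Fintype ι] {bid : ι → ℝ} {H : (ι → ℝ) → ι → ℝ}

lemma isClosed_prefersBelow (hc : ∀ j, Continuous fun t => H t j) (k : ι) (x : ℝ) :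
    IsClosed {t | PrefersBelow bid (H t) k x} := by
  have : {t | PrefersBelow bid (H t) k x} = ⋂ j : {j // k < j ∧ bid j ≤ x}, ⋃ i : {i // i ≤ k},
      {t | (x - bid j) * H t j ≤ (x - bid i) * H t i} := by
    ext t
    simp [PrefersBelow]
  rw [this]
  exact isClosed_iInter fun j => isClosed_iUnion_of_finite fun i =>
    isClosed_le ((hc _).const_mul _) ((hc _).const_mul _)

lemma isClosed_prefersAbove (hc : ∀ j, Continuous fun t => H t j) (k : ι) (x : ℝ) :
    IsClosed {t | PrefersAbove bid (H t) k x} := by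
  have : {t | PrefersAbove bid (H t) k x} = ⋃ j : {j // k < j ∧ bid j ≤ x}, ⋂ i : {i // i ≤ k},
      {t | (x - bid i) * H t i ≤ (x - bid j) * H t j} := by
    ext t
    simp [PrefersAbove, and_assoc]
  rw [this]
  exact isClosed_iUnion_of_finite fun j => isClosed_iInter fun i =>
    isClosed_le ((hc _).const_mul _) ((hc _).const_mul _)

/-- The bid `j` is affordable at value `x`, and optimal among the affordable bids. -/
def IsOptimalBid (bid : ι → ℝ) (h : ι → ℝ) (x : ℝ) (j : ι) : Prop :=
  bid j ≤ x ∧ ∀ i, bid i ≤ x → (x - bid i) * h i ≤ (x - bid j) * h j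

lemma exists_cuts (hc : ∀ j, Continuous fun t => H t j) (hm : ∀ t, Monotone (H t))
    {L : ℝ} (hL : 0 < L) {w : ℝ → ℝ} (hw : Monotone w) :
    ∃ t : ι → ℝ, (∀ i, t i ∈ Set.Icc 0 L) ∧ ∀ k,
      (∀ q, 0 ≤ q → q < t k → PrefersBelow bid (H t) k (w q)) ∧
      (∀ q, q ≤ L → t k < q → PrefersAbove bid (H t) k (w q)) := by
  obtain ⟨t, ht, hcl⟩ := exists_mem_closure_of_cover hL
    (fun k => {t | t k ≤ 0 ∨ PrefersBelow bid (H t) k (w (t k))})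
    (fun k => {t | L ≤ t k ∨ PrefersAbove bid (H t) k (w (t k))})
    (fun k t => by
      by_cases h : PrefersBelow bid (H t) k (w (t k))
      · exact Or.inl (Or.inr h)
      · exact Or.inr (Or.inr (prefersAbove_of_not_prefersBelow h)))
    (fun k t h => Or.inl h.le) (fun k t h => Or.inl h.ge)
  refine ⟨t, ht, fun k => ⟨fun q hq hqt => ?_, fun q hq hqt => ?_⟩⟩
  · have h : t ∈ {t : ι → ℝ | t k ≤ q} ∪ {t | PrefersBelow bid (H t) k (w q)} := by
      refine closure_minimal ?_ ((isClosed_le (continuous_apply k) continuous_const).union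
        (isClosed_prefersBelow hc k (w q))) (hcl k).1
      rintro t (h | h)
      · exact Or.inl (h.trans hq)
      · rcases le_total (t k) q with hle | hle
        · exact Or.inl hle
        · exact Or.inr (h.anti (hm t) (hw hle))
    exact h.resolve_left (not_le.2 hqt)
  · have h : t ∈ {t : ι → ℝ | q ≤ t k} ∪ {t | PrefersAbove bid (H t) k (w q)} := by
      refine closure_minimal ?_ ((isClosed_le continuous_const (continuous_apply k)).union
        (isClosed_prefersAbove hc k (w q))) (hcl k).2
      rintro t (h | h)
      · exact Or.inl (hq.trans h)
      · rcases le_total q (t k) with hle | hle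
        · exact Or.inl hle
        · exact Or.inr (h.mono (hm t) (hw hle))
    exact h.resolve_left (not_le.2 hqt)

/-- Some optimal bid is at most `j` if the position lies below the upper end of the region of
`j`. -/
lemma exists_isOptimalBid_le {h : ι → ℝ} (hb : Monotone bid) {j : ι} {x : ℝ}
    (hjx : bid j ≤ x) (hj : PrefersBelow bid h j x) :
    ∃ a ≤ j, IsOptimalBid bid h x a := by
  obtain ⟨a, ha, hmax⟩ := Finset.exists_max_image (univ.filter (· ≤ j))
    (fun i => (x - bid i) * h i) ⟨j, by simp⟩
  simp only [Finset.mem_filter, Finset.mem_univ, true_and] at ha hmax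
  refine ⟨a, ha, (hb ha).trans hjx, fun i hi => ?_⟩
  rcases le_or_gt i j with hij | hij
  · exact hmax i hij
  · obtain ⟨i', hi', hle⟩ := hj i hij hi
    exact hle.trans (hmax i' hi')

/-- Some optimal bid is at least `j` if the position lies above the lower end of the region of
`j`. -/
lemma exists_isOptimalBid_ge {h : ι → ℝ} {j : ι} {x : ℝ} (hx : ∃ i, bid i ≤ x)
    (hj : ∀ k < j, PrefersAbove bid h k x) :
    ∃ a ≥ j, IsOptimalBid bid h x a := by
  classical
  obtain ⟨i₀, hi₀⟩ := hx
  set M := univ.filter (fun a => IsOptimalBid bid h x a) with hM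
  have hne : M.Nonempty := by
    obtain ⟨a, ha, hmax⟩ := Finset.exists_max_image (univ.filter (bid · ≤ x))
      (fun i => (x - bid i) * h i) ⟨i₀, by simpa using hi₀⟩
    simp only [Finset.mem_filter, Finset.mem_univ, true_and] at ha hmax
    exact ⟨a, Finset.mem_filter.2 ⟨mem_univ _, ha, hmax⟩⟩
  obtain ⟨a, ha, hmax⟩ := M.exists_max_image id hne
  simp only [hM, Finset.mem_filter, Finset.mem_univ, true_and, id] at ha hmax
  refine ⟨a, ?_, ha⟩
  by_contra! hlt
  obtain ⟨b, hab, hbx, hb⟩ := hj a hlt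
  refine absurd (hmax b ⟨hbx, fun i hi => (ha.2 i hi).trans (hb a le_rfl)⟩) (not_le.2 hab)

/-- If values are strictly increasing in the position, a cut profile that is stable at every cut
is an equilibrium. -/
lemma isOptimalBid_of_cuts (hb : StrictMono bid) {h : ι → ℝ} (hm : Monotone h)
    (hnn : ∀ j, 0 ≤ h j) {L : ℝ} {w : ℝ → ℝ} (hw : StrictMono w)
    (hw0 : ∀ q, 0 ≤ q → ∃ i, bid i ≤ w q) {t : ι → ℝ} (ht : ∀ i, t i ∈ Set.Icc 0 L)
    (hcut : ∀ k, (∀ q, 0 ≤ q → q < t k → PrefersBelow bid h k (w q)) ∧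
      (∀ q, q ≤ L → t k < q → PrefersAbove bid h k (w q)))
    {j : ι} {q : ℝ} (hq1 : maxCut t (univ.filter (· < j)) < q)
    (hq2 : q < maxCut t (univ.filter (· ≤ j))) : IsOptimalBid bid h (w q) j := by
  have hq0 : 0 ≤ q := (maxCut_nonneg _ _).trans hq1.le
  obtain ⟨i, hi, hqi⟩ := (lt_maxCut hq0).1 hq2
  have hij : i = j := by
    refine le_antisymm (by simpa using hi) (not_lt.1 fun hlt => ?_)
    exact (hq1.trans hqi).not_ge (le_maxCut (by simpa using hlt))
  subst hij
  have habove : ∀ r, maxCut t (univ.filter (· < i)) < r → r < t i →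
      ∃ a ≥ i, IsOptimalBid bid h (w r) a := by
    intro r hr hri
    refine exists_isOptimalBid_ge (hw0 r ((maxCut_nonneg _ _).trans hr.le)) fun k hk => ?_
    exact (hcut k).2 r (hri.le.trans (ht i).2) ((le_maxCut (by simpa using hk)).trans_lt hr)
  obtain ⟨r, hr1, hr2⟩ := exists_between hq1
  obtain ⟨c, hic, hcr, hc⟩ := habove r hr1 (hr2.trans hqi)
  have hrq := hw hr2
  have hiq : bid i ≤ w q := ((hb.monotone hic).trans hcr).trans hrq.le
  obtain ⟨a, hai, haq, ha⟩ := exists_isOptimalBid_le hb.monotone hiq ((hcut i).1 q hq0 hqi)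
  rcases hai.eq_or_lt with rfl | hai
  · exact ⟨haq, ha⟩
  have hbac := hb (hai.trans_le hic)
  have h1 := hc a (hbac.le.trans hcr)
  have h2 := ha c (hcr.trans hrq.le)
  have hac := hm (hai.le.trans hic)
  have heq : h a = h c := by
    refine le_antisymm hac (not_lt.1 fun hlt => ?_)
    nlinarith
  have hc0 : h c = 0 := by
    refine le_antisymm (not_lt.1 fun hlt => ?_) (hnn c)
    rw [heq] at h1
    nlinarith
  have hi0 : h i = 0 := le_antisymm ((hm hic).trans hc0.le) (hnn i)
  refine ⟨hiq, fun k hk => ?_⟩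
  have := ha k hk
  rw [heq, hc0, mul_zero] at this
  rwa [hi0, mul_zero]

/-- Cuts that are stable for a value that is constant between jumps. -/
lemma exists_equilibrium_cuts [Nonempty ι] (hb : StrictMono bid)
    (hc : ∀ j, Continuous fun t => H t j)
    (hm : ∀ t, Monotone (H t)) (hnn : ∀ t j, 0 ≤ H t j) {L : ℝ} (hL : 0 < L) {w : ℝ → ℝ}
    (hw : Monotone w) (hw0 : ∀ q, 0 ≤ q → ∃ i, bid i ≤ w q) :
    ∃ t : ι → ℝ, maxCut t univ = L ∧ ∀ j q, maxCut t (univ.filter (· < j)) < q →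
      q < maxCut t (univ.filter (· ≤ j)) → IsOptimalBid bid (H t) (w q) j := by
  have hwn : ∀ n : ℕ, StrictMono fun q => w q + q / ((n : ℝ) + 1) := fun n =>
    hw.add_strictMono fun a b hab => by gcongr
  choose t ht hcut using fun n : ℕ => exists_cuts (bid := bid) hc hm hL (hwn n).monotone
  have hle : ∀ n : ℕ, ∀ q, 0 ≤ q → w q ≤ w q + q / ((n : ℝ) + 1) := fun n q hq =>
    le_add_of_nonneg_right (by positivity)
  have hopt : ∀ n j q, maxCut (t n) (univ.filter (· < j)) < q →
      q < maxCut (t n) (univ.filter (· ≤ j)) →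
      IsOptimalBid bid (H (t n)) (w q + q / ((n : ℝ) + 1)) j := fun n j q h1 h2 =>
    isOptimalBid_of_cuts hb (hm _) (hnn _) (hwn n)
      (fun q hq => (hw0 q hq).imp fun i hi => hi.trans (hle n q hq)) (ht n) (hcut n) h1 h2
  have htop : ∀ n, maxCut (t n) univ = L := by
    intro n
    refine le_antisymm (maxCut_le hL.le fun i => (ht n i).2) (not_lt.1 fun hlt => ?_)
    obtain ⟨k, -, hk⟩ := Finset.exists_max_image (univ : Finset ι) id Finset.univ_nonempty
    obtain ⟨j, hj, -⟩ := (hcut n k).2 L le_rfl ((le_maxCut (mem_univ k)).trans_lt hlt)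
    exact hj.not_ge (hk j (mem_univ j))
  obtain ⟨t', -, φ, hφ, hlim⟩ := (isCompact_Icc (a := (0 : ι → ℝ)) (b := fun _ => L)).tendsto_subseq
    (x := t) fun n => ⟨fun i => (ht n i).1, fun i => (ht n i).2⟩
  have hT : ∀ S : Finset ι, Filter.Tendsto (fun n => maxCut (t (φ n)) S) Filter.atTop
      (nhds (maxCut t' S)) := fun S => ((continuous_maxCut S).tendsto t').comp hlim
  have hHlim : ∀ i, Filter.Tendsto (fun n => H (t (φ n)) i) Filter.atTop (nhds (H t' i)) :=
    fun i => ((hc i).tendsto t').comp hlim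
  refine ⟨t', tendsto_nhds_unique (hT univ) (by simp [htop]), fun j q h1 h2 => ?_⟩
  have hq0 : 0 ≤ q := (maxCut_nonneg _ _).trans h1.le
  have hwlim : Filter.Tendsto (fun n => w q + q / ((φ n : ℝ) + 1)) Filter.atTop
      (nhds (w q)) := by
    have h := (tendsto_one_div_add_atTop_nhds_zero_nat (𝕜 := ℝ)).comp hφ.tendsto_atTop
    simpa [div_eq_mul_inv] using (h.const_mul q).const_add (w q)
  have hev : ∀ᶠ n in Filter.atTop,
      IsOptimalBid bid (H (t (φ n))) (w q + q / ((φ n : ℝ) + 1)) j := by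
    filter_upwards [(hT _).eventually_lt_const h1, (hT _).eventually_const_lt h2] with n h1 h2
    exact hopt _ _ _ h1 h2
  refine ⟨ge_of_tendsto hwlim (hev.mono fun n hn => hn.1), fun i hi => ?_⟩
  refine le_of_tendsto_of_tendsto ((hwlim.sub_const _).mul (hHlim i))
    ((hwlim.sub_const _).mul (hHlim j)) (hev.mono fun n hn => ?_)
  exact hn.2 i (hi.trans (hle _ q hq0))

end Cuts

section Auction

/-- The share of the item that bidder `i` gets under the bid profile `bb`. -/
noncomputable def winShare (n : ℕ) (i : Fin n) (bb : Fin n → ℝ) : ℝ :=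
  if ∀ k, bb k ≤ bb i then
    1 / ((Finset.univ.filter (fun j : Fin n => ∀ k, bb k ≤ bb j)).card : ℝ)
  else 0

/-- The probability that bidder `i` wins with bid `b` when all opponents' bids are independent
with distribution `P`. -/
noncomputable def winProb (n : ℕ) (B : Finset ℝ) (P : ℝ → ℝ) (i : Fin n) (b : ℝ) : ℝ :=
  ∑ bb ∈ Fintype.piFinset (fun j : Fin n => if j = i then ({b} : Finset ℝ) else B),
    (∏ j ∈ Finset.univ.erase i, P (bb j)) * winShare n i bb

lemma mem_piFinset_bid {n : ℕ} {B : Finset ℝ} {i : Fin n} {b : ℝ} {bb : Fin n → ℝ} :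
    bb ∈ Fintype.piFinset (fun j : Fin n => if j = i then ({b} : Finset ℝ) else B) ↔
      bb i = b ∧ ∀ j, j ≠ i → bb j ∈ B := by
  rw [Fintype.mem_piFinset]
  constructor
  · intro h
    exact ⟨by simpa using h i, fun j hj => by simpa [hj] using h j⟩
  · rintro ⟨h1, h2⟩ j
    by_cases hj : j = i
    · simp [hj, h1]
    · simpa [hj] using h2 j hj

lemma interim_eq_winProb (n : ℕ) (V B : Finset ℝ) (f : ℝ → ℝ) (β : ℝ → ℝ → ℝ) (i : Fin n)
    (b v : ℝ) :
    interim n (fun _ => V) B (fun _ _ => f) (fun _ => β) i b v =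
      (v - b) * winProb n B (fun c => ∑ w ∈ V, f w * β w c) i b := by
  rw [interim, winProb, Finset.mul_sum]
  refine Finset.sum_congr rfl fun bb hbb => ?_
  have hb := (mem_piFinset_bid.1 hbb).1
  have : exPost n i v bb = (v - b) * winShare n i bb := by
    rw [exPost, winShare, hb]
    split_ifs
    · rw [mul_one_div]
    · rw [mul_zero]
  rw [this]
  ring

lemma winShare_nonneg (n : ℕ) (i : Fin n) (bb : Fin n → ℝ) : 0 ≤ winShare n i bb := by
  rw [winShare]
  split_ifs <;> positivity

lemma winShare_le_one (n : ℕ) (i : Fin n) (bb : Fin n → ℝ) : winShare n i bb ≤ 1 := by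
  rw [winShare]
  split_ifs with h
  · refine div_le_one_of_le₀ ?_ (by positivity)
    exact_mod_cast Finset.card_pos.2 ⟨i, by simpa using h⟩
  · exact zero_le_one

lemma winShare_update_mono (n : ℕ) (i : Fin n) (bb : Fin n → ℝ) {b' : ℝ} (h : bb i ≤ b') :
    winShare n i bb ≤ winShare n i (Function.update bb i b') := by
  rcases h.eq_or_lt with rfl | h
  · rw [Function.update_eq_self]
  by_cases hw : ∀ k, bb k ≤ bb i
  · have hcard : Finset.univ.filter (fun j : Fin n =>
        ∀ k, Function.update bb i b' k ≤ Function.update bb i b' j) = {i} := by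
      ext j
      simp only [Finset.mem_filter, Finset.mem_univ, true_and, Finset.mem_singleton]
      constructor
      · intro hj
        by_contra hji
        have := hj i
        rw [Function.update_self, Function.update_of_ne hji] at this
        exact (h.trans_le (this.trans (hw j))).false
      · rintro rfl k
        by_cases hk : k = j
        · rw [hk]
        · rw [Function.update_self, Function.update_of_ne hk]
          exact (hw k).trans h.le
    have hi : i ∈ Finset.univ.filter (fun j : Fin n =>
        ∀ k, Function.update bb i b' k ≤ Function.update bb i b' j) := by
      rw [hcard]; simp
    have h1 : winShare n i (Function.update bb i b') = 1 := by
      rw [winShare, if_pos (Finset.mem_filter.1 hi).2, hcard]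
      simp
    rw [h1]
    exact winShare_le_one n i bb
  · rw [winShare, if_neg hw]
    exact winShare_nonneg _ _ _

lemma winProb_nonneg {n : ℕ} {B : Finset ℝ} {P : ℝ → ℝ} (hP : ∀ c, 0 ≤ P c) (i : Fin n)
    (b : ℝ) : 0 ≤ winProb n B P i b :=
  Finset.sum_nonneg fun _ _ =>
    mul_nonneg (Finset.prod_nonneg fun _ _ => hP _) (winShare_nonneg _ _ _)

lemma winProb_mono {n : ℕ} {B : Finset ℝ} {P : ℝ → ℝ} (hP : ∀ c, 0 ≤ P c) (i : Fin n) :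
    Monotone (winProb n B P i) := by
  intro b b' hbb'
  have h : winProb n B P i b' =
      ∑ bb ∈ Fintype.piFinset (fun j : Fin n => if j = i then ({b} : Finset ℝ) else B),
        (∏ j ∈ Finset.univ.erase i, P (bb j)) * winShare n i (Function.update bb i b') := by
    refine Finset.sum_nbij' (fun bb => Function.update bb i b) (fun bb => Function.update bb i b')
      ?_ ?_ ?_ ?_ ?_
    · intro bb hbb
      rw [mem_piFinset_bid] at hbb ⊢
      exact ⟨by simp, fun j hj => by simpa [hj] using hbb.2 j hj⟩
    · intro bb hbb
      rw [mem_piFinset_bid] at hbb ⊢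
      exact ⟨by simp, fun j hj => by simpa [hj] using hbb.2 j hj⟩
    · intro bb hbb
      simp [← (mem_piFinset_bid.1 hbb).1]
    · intro bb hbb
      simp [← (mem_piFinset_bid.1 hbb).1]
    · intro bb hbb
      rw [Function.update_idem, ← (mem_piFinset_bid.1 hbb).1, Function.update_eq_self]
      congr 1
      refine Finset.prod_congr rfl fun j hj => ?_
      rw [Function.update_of_ne (Finset.ne_of_mem_erase hj)]
  rw [h, winProb]
  refine Finset.sum_le_sum fun bb hbb => ?_
  refine mul_le_mul_of_nonneg_left (winShare_update_mono n i bb ?_)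
    (Finset.prod_nonneg fun _ _ => hP _)
  rwa [(mem_piFinset_bid.1 hbb).1]

lemma winShare_comp_perm {n : ℕ} (σ : Equiv.Perm (Fin n)) (i : Fin n) (bb : Fin n → ℝ) :
    winShare n i (bb ∘ σ) = winShare n (σ i) bb := by
  have hall : ∀ j, (∀ k, (bb ∘ σ) k ≤ (bb ∘ σ) j) ↔ ∀ k, bb k ≤ bb (σ j) := fun j =>
    σ.forall_congr_left.trans (by simp)
  have hcard : (Finset.univ.filter (fun j => ∀ k, (bb ∘ σ) k ≤ (bb ∘ σ) j)).card =
      (Finset.univ.filter (fun j => ∀ k, bb k ≤ bb j)).card := by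
    refine Finset.card_equiv σ fun j => ?_
    simp only [Finset.mem_filter, Finset.mem_univ, true_and]
    exact hall j
  simp only [winShare, hall i, hcard]

lemma winProb_symm {n : ℕ} (B : Finset ℝ) (P : ℝ → ℝ) (i i' : Fin n) (b : ℝ) :
    winProb n B P i b = winProb n B P i' b := by
  set σ := Equiv.swap i i' with hσ
  have hσi : σ i = i' := Equiv.swap_apply_left i i'
  have hσi' : σ i' = i := Equiv.swap_apply_right i i'
  refine Finset.sum_nbij' (fun bb => bb ∘ σ) (fun bb => bb ∘ σ) ?_ ?_ ?_ ?_ ?_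
  · intro bb hbb
    rw [mem_piFinset_bid] at hbb ⊢
    refine ⟨by simp [hσi', hbb.1], fun j hj => hbb.2 _ fun h => hj ?_⟩
    rw [← hσi, ← h, hσ, Equiv.swap_apply_self]
  · intro bb hbb
    rw [mem_piFinset_bid] at hbb ⊢
    refine ⟨by simp [hσi, hbb.1], fun j hj => hbb.2 _ fun h => hj ?_⟩
    rw [← hσi', ← h, hσ, Equiv.swap_apply_self]
  · intro bb _
    ext j
    simp [hσ]
  · intro bb _
    ext j
    simp [hσ]
  · intro bb _
    rw [winShare_comp_perm, hσi']
    congr 1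
    refine Finset.prod_equiv σ (fun j => ?_) fun j _ => ?_
    · simp only [Finset.mem_erase, Finset.mem_univ, and_true, ne_eq, not_iff_not]
      rw [← hσi, σ.injective.eq_iff]
    · simp [hσ]

/-- The fraction of the unit cell starting at `r` that lies below `x`. -/
noncomputable def cellFraction (r x : ℝ) : ℝ := max 0 (min 1 (x - r))

lemma cellFraction_mono (r : ℝ) : Monotone (cellFraction r) := fun x y h => by
  unfold cellFraction
  gcongr

lemma continuous_cellFraction (r : ℝ) : Continuous (cellFraction r) := by
  unfold cellFraction
  fun_prop

/-- The number of elements of `V` below `v`. -/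
noncomputable def valueRank (V : Finset ℝ) (v : ℝ) : ℝ := ((V.filter (· < v)).card : ℝ)

lemma valueRank_add_one_le {V : Finset ℝ} {v : ℝ} (hv : v ∈ V) {v' : ℝ} (h : v < v') :
    valueRank V v + 1 ≤ valueRank V v' := by
  have : (V.filter (· < v)).card < (V.filter (· < v')).card := by
    refine Finset.card_lt_card (Finset.ssubset_iff_of_subset ?_ |>.2 ⟨v, ?_, ?_⟩)
    · exact Finset.monotone_filter_right _ fun u _ hu => lt_trans hu h
    · simpa [hv] using h
    · simp
  unfold valueRank
  exact_mod_cast this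

lemma valueRank_add_one_le_card {V : Finset ℝ} {v : ℝ} (hv : v ∈ V) :
    valueRank V v + 1 ≤ V.card := by
  have : (V.filter (· < v)).card < V.card :=
    Finset.card_lt_card (Finset.filter_ssubset.2 ⟨v, hv, lt_irrefl v⟩)
  unfold valueRank
  exact_mod_cast this

/-- The value at a position, where the values of `V` occupy consecutive unit cells. -/
noncomputable def valueAt (V : Finset ℝ) (q : ℝ) : ℝ :=
  (V.filter fun u => valueRank V u ≤ q).fold max 0 id

lemma valueAt_nonneg (V : Finset ℝ) (q : ℝ) : 0 ≤ valueAt V q :=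
  (Finset.le_fold_max _).2 (Or.inl le_rfl)

lemma valueAt_mono (V : Finset ℝ) : Monotone (valueAt V) := by
  intro q q' h
  refine (Finset.fold_max_le _).2 ⟨valueAt_nonneg _ _, fun u hu => ?_⟩
  rw [Finset.mem_filter] at hu
  exact (Finset.le_fold_max _).2 (Or.inr ⟨u, Finset.mem_filter.2 ⟨hu.1, hu.2.trans h⟩, le_rfl⟩)

lemma valueAt_eq {V : Finset ℝ} {v q : ℝ} (hv : v ∈ V) (hv0 : 0 ≤ v) (h1 : valueRank V v ≤ q)
    (h2 : q < valueRank V v + 1) : valueAt V q = v := by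
  refine le_antisymm ((Finset.fold_max_le _).2 ⟨hv0, fun u hu => ?_⟩) ?_
  · rw [Finset.mem_filter] at hu
    refine not_lt.1 fun hlt => ?_
    exact ((valueRank_add_one_le hv hlt).trans hu.2).not_gt h2
  · exact (Finset.le_fold_max _).2 (Or.inr ⟨v, Finset.mem_filter.2 ⟨hv, h1⟩, le_rfl⟩)

lemma sum_filter_le_sub_filter_lt {α M : Type*} [LinearOrder α] [AddCommGroup M]
    (F : Finset α → M) (S : Finset α) :
    ∑ a ∈ S, (F (S.filter (· ≤ a)) - F (S.filter (· < a))) = F S - F ∅ := by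
  induction S using Finset.induction_on_max with
  | empty => simp
  | insert a S hS ih =>
    have ha : a ∉ S := fun h => (hS a h).false
    rw [Finset.sum_insert ha]
    have h1 : ∀ b ∈ S, F ((insert a S).filter (· ≤ b)) - F ((insert a S).filter (· < b)) =
        F (S.filter (· ≤ b)) - F (S.filter (· < b)) := by
      intro b hb
      rw [Finset.filter_insert, if_neg (hS b hb).not_ge, Finset.filter_insert,
        if_neg (hS b hb).not_gt]
    have h2 : (insert a S).filter (· ≤ a) = insert a S := by
      refine Finset.filter_true_of_mem fun b hb => ?_
      rcases Finset.mem_insert.1 hb with rfl | hb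
      · exact le_rfl
      · exact (hS b hb).le
    have h3 : (insert a S).filter (· < a) = S := by
      rw [Finset.filter_insert, if_neg (lt_irrefl a)]
      exact Finset.filter_true_of_mem hS
    rw [Finset.sum_congr rfl h1, ih, h2, h3]
    abel

/-- The monotone strategy in which the bid `b` is used exactly between the cuts below `b` and the
cut at `b`. -/
noncomputable def cutStrategy (V B : Finset ℝ) (t : B → ℝ) (v b : ℝ) : ℝ :=
  if h : b ∈ B then
    cellFraction (valueRank V v) (maxCut t (univ.filter (· ≤ ⟨b, h⟩))) -
      cellFraction (valueRank V v) (maxCut t (univ.filter (· < ⟨b, h⟩)))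
  else 0

variable {V B : Finset ℝ} {t : B → ℝ}

lemma maxCut_lt_le (b : B) :
    maxCut t (univ.filter (· < b)) ≤ maxCut t (univ.filter (· ≤ b)) :=
  maxCut_mono t (Finset.monotone_filter_right _ fun _ _ h => le_of_lt h)

lemma cutStrategy_nonneg (v b : ℝ) : 0 ≤ cutStrategy V B t v b := by
  unfold cutStrategy
  split_ifs with h
  · exact sub_nonneg.2 (cellFraction_mono _ (maxCut_lt_le _))
  · exact le_rfl

lemma continuous_cutStrategy (v b : ℝ) : Continuous fun t : B → ℝ => cutStrategy V B t v b := by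
  unfold cutStrategy
  split_ifs with h
  · exact ((continuous_cellFraction _).comp (continuous_maxCut _)).sub
      ((continuous_cellFraction _).comp (continuous_maxCut _))
  · exact continuous_const

lemma isDist_cutStrategy {v : ℝ} (hv : v ∈ V) (ht : maxCut t univ = V.card) :
    IsDist B (cutStrategy V B t v) := by
  refine ⟨cutStrategy_nonneg v, ?_⟩
  rw [← Finset.sum_coe_sort]
  have h := sum_filter_le_sub_filter_lt
    (fun S => cellFraction (valueRank V v) (maxCut t S)) (univ : Finset B)
  have h1 := valueRank_add_one_le_card hv
  have h0 : 0 ≤ valueRank V v := by unfold valueRank; positivity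
  have e1 : cellFraction (valueRank V v) V.card = 1 := by
    rw [cellFraction, min_eq_left (by linarith), max_eq_right zero_le_one]
  have e0 : cellFraction (valueRank V v) (maxCut t ∅) = 0 := by
    rw [cellFraction, max_eq_left]
    exact min_le_of_right_le (by simpa [maxCut] using h0)
  rw [ht, e1, e0, sub_zero] at h
  rw [← h]
  exact Finset.sum_congr rfl fun b _ => by simp [cutStrategy]

lemma cutStrategy_pos {v : ℝ} {b : B} (h : 0 < cutStrategy V B t v b) :
    maxCut t (univ.filter (· < b)) < maxCut t (univ.filter (· ≤ b)) ∧
      maxCut t (univ.filter (· < b)) < valueRank V v + 1 ∧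
      valueRank V v < maxCut t (univ.filter (· ≤ b)) := by
  simp only [cutStrategy, Finset.coe_mem, dif_pos, sub_pos] at h
  refine ⟨(cellFraction_mono _).reflect_lt h, ?_, ?_⟩
  · by_contra! hle
    refine h.not_ge ?_
    conv_rhs => rw [cellFraction, min_eq_left (by linarith), max_eq_right zero_le_one]
    exact max_le zero_le_one (min_le_left _ _)
  · by_contra! hle
    refine h.not_ge ?_
    conv_lhs => rw [cellFraction, max_eq_left (min_le_of_right_le (by linarith))]
    exact le_max_left _ _

lemma monotoneStrat_cutStrategy : MonotoneStrat V B (cutStrategy V B t) := by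
  intro v hv v' _ hvv' b hb b' hb' hpos hpos'
  by_contra! hlt
  have h1 := (cutStrategy_pos (b := ⟨b, hb⟩) hpos).2.1
  have h2 := (cutStrategy_pos (b := ⟨b', hb'⟩) hpos').2.2
  have h3 : maxCut t (univ.filter (· ≤ (⟨b', hb'⟩ : B))) ≤
      maxCut t (univ.filter (· < (⟨b, hb⟩ : B))) :=
    maxCut_mono t (Finset.monotone_filter_right _ fun c _ hc => lt_of_le_of_lt hc hlt)
  linarith [valueRank_add_one_le hv hvv']

end Auction

/-- Every discrete first-price auction with iid priors (common value
space `V0 ⊆ [0,1]`, bid space `B ⊆ [0,1]` with `0 ∈ B`, common prior pmf `f0` on `V0`)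
has an exact (0-approximate) mixed Bayes–Nash equilibrium which is symmetric,
monotone, and non-overbidding. -/
theorem stmt0 (n : ℕ) (hn : 2 ≤ n) (V0 B : Finset ℝ)
    (hV : ↑V0 ⊆ Set.Icc (0:ℝ) 1) (hB : ↑B ⊆ Set.Icc (0:ℝ) 1) (h0B : (0:ℝ) ∈ B)
    (f0 : ℝ → ℝ) (hf0nn : ∀ v, 0 ≤ f0 v) (hf0supp : ∀ v, v ∉ V0 → f0 v = 0)
    (hf0sum : ∑ v ∈ V0, f0 v = 1) :
    ∃ β0 : ℝ → ℝ → ℝ,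
      (∀ v ∈ V0, IsDist B (β0 v)) ∧
      MonotoneStrat V0 B β0 ∧
      (∀ v ∈ V0, ∀ b ∈ B, v < b → β0 v b = 0) ∧
      MBNE n (fun _ => V0) B (fun _ _ => f0) (fun _ => β0) 0 := by
  set P : (B → ℝ) → ℝ → ℝ := fun t c => ∑ w ∈ V0, f0 w * cutStrategy V0 B t w c with hP
  have hPnn : ∀ t c, 0 ≤ P t c := fun t c =>
    Finset.sum_nonneg fun w _ => mul_nonneg (hf0nn w) (cutStrategy_nonneg w c)
  have hPc : ∀ c, Continuous fun t => P t c := fun c =>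
    continuous_finsetSum _ fun w _ => (continuous_cutStrategy w c).const_mul _
  have hVne : V0.Nonempty := by
    rw [Finset.nonempty_iff_ne_empty]
    rintro rfl
    simp at hf0sum
  let i₀ : Fin n := ⟨0, by omega⟩
  have : Nonempty B := ⟨⟨0, h0B⟩⟩
  obtain ⟨t, htop, ht⟩ := exists_equilibrium_cuts (ι := B) (bid := fun b => (b : ℝ))
    (H := fun t b => winProb n B (P t) i₀ b) (L := (V0.card : ℝ)) (w := valueAt V0)
    (fun _ _ h => h)
    (fun b => continuous_finsetSum _ fun bb _ =>
      (continuous_finsetProd _ fun j _ => hPc (bb j)).mul continuous_const)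
    (fun t b b' h => winProb_mono (hPnn t) i₀ h) (fun t b => winProb_nonneg (hPnn t) i₀ b)
    (by exact_mod_cast hVne.card_pos) (valueAt_mono V0)
    (fun q _ => ⟨⟨0, h0B⟩, valueAt_nonneg V0 q⟩)
  have hopt : ∀ v ∈ V0, ∀ b : B, 0 < cutStrategy V0 B t v b →
      IsOptimalBid (fun b : B => (b : ℝ)) (fun b => winProb n B (P t) i₀ b) v b := by
    intro v hv b hb
    obtain ⟨h1, h2, h3⟩ := cutStrategy_pos hb
    obtain ⟨q, hq1, hq2⟩ := exists_between (max_lt (lt_min h1 h2) (lt_min h3 (lt_add_one _)))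
    rw [max_lt_iff] at hq1
    rw [lt_min_iff] at hq2
    have := ht b q hq1.1 hq2.1
    rwa [valueAt_eq hv (hV hv).1 hq1.2.le hq2.2] at this
  have hbest : ∀ v ∈ V0, ∀ b ∈ B, 0 < cutStrategy V0 B t v b → ∀ b' ∈ B,
      (v - b') * winProb n B (P t) i₀ b' ≤ (v - b) * winProb n B (P t) i₀ b := by
    intro v hv b hb hpos b' hb'
    have h := (hopt v hv ⟨b, hb⟩ hpos).2
    rcases le_or_gt b' v with hle | hlt
    · exact h ⟨b', hb'⟩ hle
    · have hzero := h ⟨0, h0B⟩ (hV hv).1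
      refine le_trans (b := 0) ?_ (le_trans ?_ hzero)
      · exact mul_nonpos_of_nonpos_of_nonneg (by linarith) (winProb_nonneg (hPnn t) i₀ b')
      · exact mul_nonneg (by simpa using (hV hv).1) (winProb_nonneg (hPnn t) i₀ _)
  have hdist : ∀ v ∈ V0, IsDist B (cutStrategy V0 B t v) := fun v hv =>
    isDist_cutStrategy hv htop
  refine ⟨cutStrategy V0 B t, hdist, monotoneStrat_cutStrategy, ?_, ?_⟩
  · intro v hv b hb hvb
    by_contra hne
    exact (hopt v hv ⟨b, hb⟩ ((cutStrategy_nonneg v b).lt_of_ne' hne)).1.not_gt hvb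
  · intro i v hv γ hγ
    obtain ⟨b, hb, hpos⟩ := Finset.exists_ne_zero_of_sum_ne_zero
      ((hdist v hv).2.trans_ne one_ne_zero)
    have hpos := (cutStrategy_nonneg v b).lt_of_ne' hpos
    have hu : ∀ b, interim n (fun _ => V0) B (fun _ _ => f0) (fun _ => cutStrategy V0 B t) i b v =
        (v - b) * winProb n B (P t) i₀ b := by
      intro b
      rw [interim_eq_winProb, winProb_symm B _ i i₀]
    simp only [interimMix, hu, sub_zero, ge_iff_le]
    set u : ℝ → ℝ := fun b => (v - b) * winProb n B (P t) i₀ b with hu'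
    calc ∑ b ∈ B, γ b * u b ≤ ∑ c ∈ B, γ c * u b :=
          Finset.sum_le_sum fun c hc =>
            mul_le_mul_of_nonneg_left (hbest v hv b hb hpos c hc) (hγ.1 c)
      _ = ∑ c ∈ B, cutStrategy V0 B t v c * u b := by
          rw [← Finset.sum_mul, ← Finset.sum_mul, hγ.2, (hdist v hv).2]
      _ ≤ ∑ c ∈ B, cutStrategy V0 B t v c * u c := by
          refine Finset.sum_le_sum fun c hc => ?_
          rcases (cutStrategy_nonneg (V := V0) (t := t) v c).eq_or_lt with h | h
          · rw [← h, zero_mul, zero_mul]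
          · exact mul_le_mul_of_nonneg_left (hbest v hv c hc h b hb) h.le
end

section
/- For every ε with 0 ≤ ε < 1/72 there exists a discrete first-price auction with exactly two bidders and iid priors whose support has size 2 that admits no non-overbidding ε-approximate pure Bayes–Nash equilibrium. -/
open Finset

/-- The mixed-strategy profile corresponding to a pure strategy profile `βh`. -/
noncomputable def pureToMixed (n : ℕ) (βh : Fin n → ℝ → ℝ) : Fin n → ℝ → ℝ → ℝ :=
  fun i v b => if βh i v = b then 1 else 0

/-- `βh` is an ε-approximate pure Bayes–Nash equilibrium. -/
def PurePBNE (n : ℕ) (V : Fin n → Finset ℝ) (B : Finset ℝ)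
    (f : Fin n → Fin n → ℝ → ℝ) (βh : Fin n → ℝ → ℝ) (ε : ℝ) : Prop :=
  ∀ i : Fin n, ∀ v ∈ V i, ∀ b ∈ B,
    interim n V B f (pureToMixed n βh) i (βh i v) v ≥
      interim n V B f (pureToMixed n βh) i b v - ε

/-- Payoff of a two-bidder first-price auction to a bidder with value `v` who bids `b` against
an opponent bidding `c`. -/
noncomputable def duelPayoff (v b c : ℝ) : ℝ :=
  if c < b then v - b else if c = b then (v - b) / 2 else 0

lemma exPost_two {i j : Fin 2} (hij : i ≠ j) (v : ℝ) (bb : Fin 2 → ℝ) :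
    exPost 2 i v bb = duelPayoff v (bb i) (bb j) := by
  have hall : ∀ k : Fin 2, (∀ l, bb l ≤ bb k) ↔ bb i ≤ bb k ∧ bb j ≤ bb k := by
    intro k
    refine ⟨fun h => ⟨h i, h j⟩, fun h l => ?_⟩
    obtain rfl | rfl : l = i ∨ l = j := by omega
    exacts [h.1, h.2]
  have huniv : (Finset.univ : Finset (Fin 2)) = {i, j} := by
    ext k
    simp only [Finset.mem_univ, Finset.mem_insert, Finset.mem_singleton, true_iff]
    omega
  unfold exPost duelPayoff
  simp only [hall, huniv, Finset.filter_insert, Finset.filter_singleton, le_refl, true_and,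
    and_true]
  rcases lt_trichotomy (bb i) (bb j) with h | h | h
  · simp [h.not_ge, h.not_gt, h.ne']
  · simp [h, hij]
  · simp [h, h.le, h.not_ge]

/-- Against an opponent playing a pure strategy with bids in `B`, the interim utility is the
expected payoff over the opponent's values. -/
lemma interim_two_pure {i j : Fin 2} (hij : i ≠ j) (V : Fin 2 → Finset ℝ) (B : Finset ℝ)
    (f : Fin 2 → Fin 2 → ℝ → ℝ) (βh : Fin 2 → ℝ → ℝ) (hβ : ∀ w ∈ V j, βh j w ∈ B) (b v : ℝ) :
    interim 2 V B f (pureToMixed 2 βh) i b v =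
      ∑ w ∈ V j, f i j w * duelPayoff v b (βh j w) := by
  have herase : Finset.univ.erase i = {j} := by
    ext k
    simp only [Finset.mem_erase, Finset.mem_univ, and_true, Finset.mem_singleton]
    omega
  have hopp : interim 2 V B f (pureToMixed 2 βh) i b v =
      ∑ c ∈ B, (∑ w ∈ V j, f i j w * pureToMixed 2 βh j w c) * duelPayoff v b c := by
    unfold interim
    refine Finset.sum_nbij' (fun bb => bb j) (fun c k => if k = i then b else c) ?_ ?_ ?_ ?_ ?_
    · intro bb hbb
      simpa [hij.symm] using Fintype.mem_piFinset.1 hbb j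
    · intro c hc
      refine Fintype.mem_piFinset.2 fun k => ?_
      by_cases hk : k = i <;> simp [hk, hc]
    · intro bb hbb
      funext k
      by_cases hk : k = i
      · subst hk
        have hk := Fintype.mem_piFinset.1 hbb k
        simp only [if_true, Finset.mem_singleton] at hk
        simp [hk]
      · obtain rfl : k = j := by omega
        simp [hk]
    · intro c _
      simp [hij.symm]
    · intro bb hbb
      have hi : bb i = b := by simpa using Fintype.mem_piFinset.1 hbb i
      rw [herase, Finset.prod_singleton, exPost_two hij, hi]
  rw [hopp]
  simp only [Finset.sum_mul]
  rw [Finset.sum_comm]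
  refine Finset.sum_congr rfl fun w hw => ?_
  simp [pureToMixed, hβ w hw]

/-- For every `0 ≤ ε < 1/72` there is a discrete first-price auction
with exactly two bidders and iid priors whose support has size 2 that admits no
non-overbidding ε-approximate pure Bayes–Nash equilibrium. -/
theorem stmt2 (ε : ℝ) (hε0 : 0 ≤ ε) (hε : ε < 1/72) :
    ∃ (V0 B : Finset ℝ) (f0 : ℝ → ℝ),
      ↑V0 ⊆ Set.Icc (0:ℝ) 1 ∧ ↑B ⊆ Set.Icc (0:ℝ) 1 ∧ (0:ℝ) ∈ B ∧
      V0.card = 2 ∧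
      (∀ v, 0 ≤ f0 v) ∧ (∀ v, v ∉ V0 → f0 v = 0) ∧ (∑ v ∈ V0, f0 v = 1) ∧
      (∀ v ∈ V0, 0 < f0 v) ∧
      ¬ ∃ βh : Fin 2 → ℝ → ℝ,
          (∀ i : Fin 2, ∀ v ∈ V0, βh i v ∈ B ∧ βh i v ≤ v) ∧
          PurePBNE 2 (fun _ => V0) B (fun _ _ => f0) βh ε := by
  refine ⟨{0, 1}, {0, 1 / 8, 1 / 4, 3 / 8},
    fun v => if v = 0 then 3 / 5 else if v = 1 then 2 / 5 else 0,
    ?_, ?_, by simp, by simp, ?_, ?_, by norm_num, ?_, ?_⟩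
  · intro v hv
    simp only [Finset.coe_insert, Finset.coe_singleton, Set.mem_insert_iff,
      Set.mem_singleton_iff] at hv
    rcases hv with rfl | rfl <;> norm_num
  · intro v hv
    simp only [Finset.coe_insert, Finset.coe_singleton, Set.mem_insert_iff,
      Set.mem_singleton_iff] at hv
    rcases hv with rfl | rfl | rfl | rfl <;> norm_num
  · intro v
    dsimp only
    split_ifs <;> norm_num
  · intro v hv
    simp only [Finset.mem_insert, Finset.mem_singleton, not_or] at hv
    simp [hv]
  · intro v hv
    simp only [Finset.mem_insert, Finset.mem_singleton] at hv
    rcases hv with rfl | rfl <;> norm_num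
  rintro ⟨βh, hβ, heq⟩
  have hmem : ∀ (j : Fin 2) (x : ℝ), x ∈ ({0, 1} : Finset ℝ) →
      βh j x ∈ ({0, 1 / 8, 1 / 4, 3 / 8} : Finset ℝ) := fun j x hx => (hβ j x hx).1
  have hzero : ∀ j, βh j 0 = 0 := by
    intro j
    obtain ⟨hB, hle⟩ := hβ j 0 (by simp)
    simp only [Finset.mem_insert, Finset.mem_singleton] at hB
    rcases hB with h | h | h | h <;> linarith
  have hhigh : ∀ i j : Fin 2, i ≠ j → ∀ b ∈ ({0, 1 / 8, 1 / 4, 3 / 8} : Finset ℝ),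
      3 / 5 * duelPayoff 1 b 0 + 2 / 5 * duelPayoff 1 b (βh j 1) - ε ≤
        3 / 5 * duelPayoff 1 (βh i 1) 0 + 2 / 5 * duelPayoff 1 (βh i 1) (βh j 1) := by
    intro i j hij b hb
    have h := heq i 1 (by simp) b hb
    rw [interim_two_pure hij _ _ _ _ (hmem j), interim_two_pure hij _ _ _ _ (hmem j)] at h
    simpa [hzero j] using h
  have h01 := hhigh 0 1 (by decide)
  have h10 := hhigh 1 0 (by decide)
  have hx := hmem 0 1 (by simp)
  have hy := hmem 1 1 (by simp)
  simp only [Finset.forall_mem_insert, Finset.mem_singleton, forall_eq] at h01 h10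
  simp only [Finset.mem_insert, Finset.mem_singleton] at hx hy
  rcases hx with hx | hx | hx | hx <;> rcases hy with hy | hy | hy | hy <;>
    (rw [hx, hy] at h01 h10
     norm_num [duelPayoff] at h01 h10
     grind)
end

section
/- For every δ ∈ (0,1) and every discrete first-price auction there exists a continuous first-price auction with the same set of bidders and the same bidding space, whose subjective priors have piecewise constant densities on [0,1], such that for every ε ≥ 0 and every ε-approximate pure Bayes–Nash equilibrium β' of the continuous auction there exists an (ε+δ)-well-supported, monotone, non-overbidding mixed Bayes–Nash equilibrium β of the discrete auction. Moreover, the continuous auction is iid whenever the discrete auction is iid, and β can be chosen symmetric whenever all discrete value spaces coincide and β' is symmetric. -/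
open MeasureTheory

open Finset

/-- A function is piecewise constant if there is a finite set `S` of breakpoints such
that the function is constant on each connected component of `ℝ ∖ S`. -/
def PiecewiseConstant (ρ : ℝ → ℝ) : Prop :=
  ∃ S : Finset ℝ, ∀ x y : ℝ, x ∉ S → y ∉ S →
    (∀ s ∈ S, ¬(x < s ∧ s < y) ∧ ¬(y < s ∧ s < x)) → ρ x = ρ y

/-- `ρ` is a piecewise constant probability density on `[0,1]`. -/
def IsPCDensity (ρ : ℝ → ℝ) : Prop :=
  (∀ x, 0 ≤ ρ x) ∧ (∀ x, x ∉ Set.Icc (0:ℝ) 1 → ρ x = 0) ∧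
    (∫ x, ρ x = 1) ∧ PiecewiseConstant ρ

/-- Interim utility of bidder `i` bidding `b` with value `v` in a continuous
first-price auction whose subjective priors have densities `ρ i j`: each opponent
`j`'s value is drawn from the density `ρ i j` and mapped through her pure strategy
`β j`. -/
noncomputable def cInterim (n : ℕ) (ρ : Fin n → Fin n → ℝ → ℝ)
    (β : Fin n → ℝ → ℝ) (i : Fin n) (b : ℝ) (v : ℝ) : ℝ :=
  ∫ vv : Fin n → ℝ,
    exPost n i v (Function.update (fun j => β j (vv j)) i b)
    ∂(MeasureTheory.Measure.pi (fun j : Fin n =>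
        if j = i then MeasureTheory.Measure.dirac 0
        else MeasureTheory.volume.withDensity (fun x => ENNReal.ofReal (ρ i j x))))

/-- A pure-strategy profile of the continuous auction: each `β i` is a non-decreasing
(step) function from values in `[0,1]` to bids in `B`, with no overbidding. -/
def CPureProfile (n : ℕ) (B : Finset ℝ) (β : Fin n → ℝ → ℝ) : Prop :=
  ∀ i : Fin n, MonotoneOn (β i) (Set.Icc (0:ℝ) 1) ∧
    ∀ v ∈ Set.Icc (0:ℝ) 1, β i v ∈ B ∧ β i v ≤ v

/-- `β` is an ε-approximate pure Bayes–Nash equilibrium of the continuous auction. -/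
def CPBNE (n : ℕ) (B : Finset ℝ) (ρ : Fin n → Fin n → ℝ → ℝ)
    (β : Fin n → ℝ → ℝ) (ε : ℝ) : Prop :=
  ∀ i : Fin n, ∀ v ∈ Set.Icc (0:ℝ) 1, ∀ b ∈ B,
    cInterim n ρ β i (β i v) v ≥ cInterim n ρ β i b v - ε

/-- The interval of length `η` that replaces the atom at the value `v`; it stays inside
`[0,1]` when `v` and `η` lie in `[0,1]`. -/
def cell (η v : ℝ) : Set ℝ := Set.Icc (v * (1 - η)) (v * (1 - η) + η)

/-- The density obtained from the weights `p` on `W` by spreading the mass at each `w ∈ W`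
uniformly over `cell η w`. -/
noncomputable def smear (η : ℝ) (W : Finset ℝ) (p : ℝ → ℝ) (x : ℝ) : ℝ :=
  ∑ w ∈ W, (cell η w).indicator (fun _ => p w * η⁻¹) x

/-- The mixed strategy that at value `v` draws a uniform point of `cell η v` and bids
according to the pure strategy `h`. -/
noncomputable def cellStrat (η : ℝ) (h : ℝ → ℝ) (v b : ℝ) : ℝ :=
  η⁻¹ * volume.real (h ⁻¹' {b} ∩ cell η v)

/-- The extension of a strategy on `[0,1]` to the real line, constant outside `[0,1]`. -/
noncomputable def extendStrat (g : ℝ → ℝ) (x : ℝ) : ℝ :=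
  g (Set.projIcc (0 : ℝ) 1 zero_le_one x)

lemma measurableSet_cell (η v : ℝ) : MeasurableSet (cell η v) := measurableSet_Icc

lemma volume_real_cell {η : ℝ} (hη : 0 ≤ η) (v : ℝ) : volume.real (cell η v) = η := by
  simp [cell, hη]

lemma volume_cell_ne_top (η v : ℝ) : volume (cell η v) ≠ ⊤ := by simp [cell]

lemma cell_subset_Icc {η v : ℝ} (hη1 : η ≤ 1) (hv : v ∈ Set.Icc (0 : ℝ) 1) :
    cell η v ⊆ Set.Icc 0 1 := by
  rintro x ⟨h1, h2⟩
  obtain ⟨h3, h4⟩ := hv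
  constructor <;> nlinarith

lemma abs_sub_le_of_mem_cell {η v x : ℝ} (hv : v ∈ Set.Icc (0 : ℝ) 1)
    (hx : x ∈ cell η v) : |v - x| ≤ η := by
  obtain ⟨h1, h2⟩ := hx
  obtain ⟨h3, h4⟩ := hv
  rw [abs_le]
  constructor <;> nlinarith

lemma exists_pos_lt_gaps (U : Finset ℝ) {δ : ℝ} (hδ : 0 < δ) :
    ∃ η : ℝ, 0 < η ∧ 2 * η < δ ∧ ∀ x ∈ U, ∀ y ∈ U, x < y → 2 * η < y - x := by
  have key : ∀ c : ℝ, 0 < c → ∀ᶠ η in nhdsWithin (0 : ℝ) (Set.Ioi 0), 2 * η < c := by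
    intro c hc
    filter_upwards [Ioo_mem_nhdsGT (show (0 : ℝ) < c / 2 by positivity)] with η hη
    linarith [hη.2]
  have hall : ∀ᶠ η in nhdsWithin (0 : ℝ) (Set.Ioi 0),
      ∀ x ∈ U, ∀ y ∈ U, x < y → 2 * η < y - x := by
    rw [Filter.eventually_all_finset]
    intro x _
    rw [Filter.eventually_all_finset]
    intro y _
    by_cases hxy : x < y
    · filter_upwards [key (y - x) (sub_pos.2 hxy)] with η hη _ using hη
    · exact Filter.Eventually.of_forall fun _ h => absurd h hxy
  have hpos : ∀ᶠ η in nhdsWithin (0 : ℝ) (Set.Ioi 0), 0 < η := self_mem_nhdsWithin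
  obtain ⟨η, h1, h2, h3⟩ := (hpos.and ((key δ hδ).and hall)).exists
  exact ⟨η, h1, h2, h3⟩

lemma smear_nonneg {η : ℝ} (hη : 0 ≤ η) {W : Finset ℝ} {p : ℝ → ℝ} (hp : ∀ w, 0 ≤ p w)
    (x : ℝ) : 0 ≤ smear η W p x :=
  Finset.sum_nonneg fun w _ =>
    Set.indicator_nonneg (fun _ _ => mul_nonneg (hp w) (inv_nonneg.2 hη)) x

lemma isPCDensity_smear {η : ℝ} (hη0 : 0 < η) (hη1 : η ≤ 1) {W : Finset ℝ}
    (hW : (W : Set ℝ) ⊆ Set.Icc 0 1) {p : ℝ → ℝ} (hp : ∀ w, 0 ≤ p w)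
    (hsum : ∑ w ∈ W, p w = 1) : IsPCDensity (smear η W p) := by
  refine ⟨smear_nonneg hη0.le hp, ?_, ?_, ?_⟩
  · intro x hx
    exact Finset.sum_eq_zero fun w hw =>
      Set.indicator_of_notMem (fun h => hx (cell_subset_Icc hη1 (hW hw) h)) _
  · simp only [smear]
    rw [integral_finsetSum]
    · rw [← hsum]
      refine Finset.sum_congr rfl fun w _ => ?_
      rw [integral_indicator_const _ (measurableSet_cell η w), volume_real_cell hη0.le,
        smul_eq_mul]
      field_simp
    · intro w _
      exact (integrable_indicator_iff (measurableSet_cell η w)).2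
        (integrableOn_const (volume_cell_ne_top η w))
  · refine ⟨W.image (fun w => w * (1 - η)) ∪ W.image (fun w => w * (1 - η) + η), ?_⟩
    intro x y hx hy hxy
    refine Finset.sum_congr rfl fun w hw => ?_
    have ha : w * (1 - η) ∈ W.image (fun w => w * (1 - η)) ∪
        W.image (fun w => w * (1 - η) + η) :=
      Finset.mem_union_left _ (Finset.mem_image_of_mem _ hw)
    have hb : w * (1 - η) + η ∈ W.image (fun w => w * (1 - η)) ∪
        W.image (fun w => w * (1 - η) + η) :=
      Finset.mem_union_right _ (Finset.mem_image_of_mem (fun w => w * (1 - η) + η) hw)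
    have hiff : x ∈ cell η w ↔ y ∈ cell η w := by
      have hle : ∀ a : ℝ, ¬(x < a ∧ a < y) ∧ ¬(y < a ∧ a < x) → a ≠ x → a ≠ y →
          (x < a ↔ y < a) := fun a h hax hay =>
        ⟨fun h' => lt_of_not_ge fun h'' => h.1 ⟨h', h''.lt_of_ne hay⟩,
          fun h' => lt_of_not_ge fun h'' => h.2 ⟨h', h''.lt_of_ne hax⟩⟩
      have hbx := ne_of_mem_of_not_mem hb hx
      have hby := ne_of_mem_of_not_mem hb hy
      have h1 := hle _ (hxy _ ha) (ne_of_mem_of_not_mem ha hx) (ne_of_mem_of_not_mem ha hy)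
      have h2 := hle _ (hxy _ hb) hbx hby
      rw [cell, Set.mem_Icc, Set.mem_Icc, ← not_lt, h1, not_lt, hbx.symm.le_iff_lt, h2,
        hby.symm.le_iff_lt]
    by_cases h : x ∈ cell η w
    · rw [Set.indicator_of_mem h, Set.indicator_of_mem (hiff.1 h)]
    · rw [Set.indicator_of_notMem h, Set.indicator_of_notMem (mt hiff.2 h)]

lemma withDensity_smear_apply {η : ℝ} (hη : 0 ≤ η) {W : Finset ℝ} {p : ℝ → ℝ}
    (hp : ∀ w, 0 ≤ p w) {s : Set ℝ} (hs : MeasurableSet s) :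
    volume.withDensity (fun x => ENNReal.ofReal (smear η W p x)) s =
      ∑ w ∈ W, ENNReal.ofReal (p w * η⁻¹) * volume (s ∩ cell η w) := by
  have hpt : ∀ x, ENNReal.ofReal (smear η W p x) =
      ∑ w ∈ W, (cell η w).indicator (fun _ => ENNReal.ofReal (p w * η⁻¹)) x := by
    intro x
    rw [smear, ENNReal.ofReal_sum_of_nonneg fun w _ =>
      Set.indicator_nonneg (fun _ _ => mul_nonneg (hp w) (inv_nonneg.2 hη)) x]
    refine Finset.sum_congr rfl fun w _ => ?_
    by_cases h : x ∈ cell η w <;> simp [h]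
  rw [withDensity_apply _ hs]
  simp only [hpt]
  rw [lintegral_finsetSum _ fun w _ => measurable_const.indicator (measurableSet_cell η w)]
  refine Finset.sum_congr rfl fun w _ => ?_
  rw [lintegral_indicator_const (measurableSet_cell η w),
    Measure.restrict_apply (measurableSet_cell η w), Set.inter_comm]

lemma withDensity_smear_real {η : ℝ} (hη : 0 ≤ η) {W : Finset ℝ} {p : ℝ → ℝ}
    (hp : ∀ w, 0 ≤ p w) {h : ℝ → ℝ} (hh : Measurable h) (b : ℝ) :
    (volume.withDensity (fun x => ENNReal.ofReal (smear η W p x))).real (h ⁻¹' {b}) =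
      ∑ w ∈ W, p w * cellStrat η h w b := by
  rw [measureReal_def, withDensity_smear_apply hη hp (hh (measurableSet_singleton b)),
    ENNReal.toReal_sum]
  · refine Finset.sum_congr rfl fun w _ => ?_
    rw [ENNReal.toReal_mul, ENNReal.toReal_ofReal (mul_nonneg (hp w) (inv_nonneg.2 hη)),
      cellStrat, measureReal_def, mul_assoc]
  · intro w _
    exact ENNReal.mul_ne_top ENNReal.ofReal_ne_top
      (measure_ne_top_of_subset Set.inter_subset_right (volume_cell_ne_top η w))

lemma isFiniteMeasure_smear {η : ℝ} (hη : 0 ≤ η) {W : Finset ℝ} {p : ℝ → ℝ}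
    (hp : ∀ w, 0 ≤ p w) :
    IsFiniteMeasure (volume.withDensity (fun x => ENNReal.ofReal (smear η W p x))) := by
  constructor
  rw [withDensity_smear_apply hη hp MeasurableSet.univ, ENNReal.sum_lt_top]
  intro w _
  exact ENNReal.mul_lt_top ENNReal.ofReal_lt_top
    (lt_of_le_of_lt (measure_mono Set.inter_subset_right) (volume_cell_ne_top η w).lt_top)

lemma ae_mem_Icc_smear {η : ℝ} (hη0 : 0 ≤ η) (hη1 : η ≤ 1) {W : Finset ℝ}
    (hW : (W : Set ℝ) ⊆ Set.Icc 0 1) {p : ℝ → ℝ} (hp : ∀ w, 0 ≤ p w) :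
    ∀ᵐ x ∂(volume.withDensity (fun x => ENNReal.ofReal (smear η W p x))),
      x ∈ Set.Icc (0 : ℝ) 1 := by
  rw [ae_iff]
  change volume.withDensity _ (Set.Icc (0 : ℝ) 1)ᶜ = 0
  rw [withDensity_smear_apply hη0 hp measurableSet_Icc.compl]
  refine Finset.sum_eq_zero fun w hw => ?_
  have : (Set.Icc (0 : ℝ) 1)ᶜ ∩ cell η w = ∅ :=
    (Set.disjoint_compl_left_iff_subset.2 (cell_subset_Icc hη1 (hW hw))).inter_eq
  rw [this, measure_empty, mul_zero]

lemma cellStrat_nonneg {η : ℝ} (hη : 0 ≤ η) (h : ℝ → ℝ) (v b : ℝ) : 0 ≤ cellStrat η h v b :=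
  mul_nonneg (inv_nonneg.2 hη) measureReal_nonneg

lemma exists_mem_cell_of_cellStrat_ne_zero {η : ℝ} {h : ℝ → ℝ} {v b : ℝ}
    (hb : cellStrat η h v b ≠ 0) : ∃ x ∈ cell η v, h x = b := by
  by_contra! hne
  refine hb ?_
  have : h ⁻¹' {b} ∩ cell η v = ∅ := by
    ext x
    simp only [Set.mem_inter_iff, Set.mem_preimage, Set.mem_singleton_iff,
      Set.mem_empty_iff_false, iff_false, not_and]
    exact fun hx hc => hne x hc hx
  rw [cellStrat, this, measureReal_empty, mul_zero]

lemma isDist_cellStrat {η : ℝ} (hη : 0 < η) {h : ℝ → ℝ} (hh : Measurable h) {B : Finset ℝ}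
    (hB : ∀ x, h x ∈ B) (v : ℝ) : IsDist B (cellStrat η h v) := by
  refine ⟨cellStrat_nonneg hη.le h v, ?_⟩
  simp only [cellStrat]
  rw [← Finset.mul_sum, ← measureReal_biUnion_finset (h := fun b _ =>
    measure_ne_top_of_subset Set.inter_subset_right (volume_cell_ne_top η v))]
  · have : ⋃ b ∈ B, h ⁻¹' {b} ∩ cell η v = cell η v := by
      ext x
      simp only [Set.mem_iUnion, Set.mem_inter_iff, Set.mem_preimage, Set.mem_singleton_iff]
      exact ⟨fun ⟨_, _, _, hx⟩ => hx, fun hx => ⟨h x, hB x, rfl, hx⟩⟩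
    rw [this, volume_real_cell hη.le, inv_mul_cancel₀ hη.ne']
  · intro b _ c _ hbc
    refine Set.disjoint_left.2 fun x hx hx' => hbc ?_
    exact hx.1.symm.trans hx'.1
  · exact fun b _ => (hh (measurableSet_singleton b)).inter (measurableSet_cell η v)

lemma extendStrat_of_mem {g : ℝ → ℝ} {x : ℝ} (hx : x ∈ Set.Icc (0 : ℝ) 1) :
    extendStrat g x = g x := by
  rw [extendStrat, Set.projIcc_of_mem _ hx]

lemma monotone_extendStrat {g : ℝ → ℝ} (hg : MonotoneOn g (Set.Icc 0 1)) :
    Monotone (extendStrat g) := fun _ _ hxy =>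
  hg (Subtype.coe_prop _) (Subtype.coe_prop _) (Set.monotone_projIcc _ hxy)

/-- The expectation of a function of independent coordinatewise images with finitely many
values is a finite sum. -/
lemma integral_pi_comp_eq_sum {ι : Type*} [Fintype ι] (μ : ι → Measure ℝ)
    [∀ j, IsFiniteMeasure (μ j)] {g : ι → ℝ → ℝ} (hg : ∀ j, Measurable (g j))
    (T : ι → Finset ℝ) [DecidableEq ι] (hT : ∀ j x, g j x ∈ T j) (F : (ι → ℝ) → ℝ) :
    ∫ x, F (fun j => g j (x j)) ∂Measure.pi μ =
      ∑ y ∈ Fintype.piFinset T, (∏ j, (μ j).real (g j ⁻¹' {y j})) * F y := by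
  have hms : ∀ y : ι → ℝ, MeasurableSet (Set.univ.pi fun j => g j ⁻¹' {y j}) := fun y =>
    MeasurableSet.univ_pi fun j => hg j (measurableSet_singleton _)
  have hpt : ∀ x : ι → ℝ, F (fun j => g j (x j)) = ∑ y ∈ Fintype.piFinset T,
      (Set.univ.pi fun j => g j ⁻¹' {y j}).indicator (fun _ => F y) x := by
    intro x
    rw [Finset.sum_eq_single (fun j => g j (x j))]
    · rw [Set.indicator_of_mem]
      simp
    · intro y _ hy
      refine Set.indicator_of_notMem (fun hx => hy ?_) _
      funext j
      exact (hx j (Set.mem_univ j)).symm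
    · intro hx
      exact absurd (Fintype.mem_piFinset.2 fun j => hT j (x j)) hx
  simp only [hpt]
  rw [integral_finsetSum _ fun y _ => (integrable_const (F y)).indicator (hms y)]
  refine Finset.sum_congr rfl fun y _ => ?_
  rw [integral_indicator_const _ (hms y), smul_eq_mul, measureReal_def, Measure.pi_pi,
    ENNReal.toReal_prod]
  rfl

/-- The interim utilities of the smeared auction agree with those of the discrete auction. -/
lemma cInterim_smear_eq_interim {n : ℕ} {V : Fin n → Finset ℝ} {B : Finset ℝ}
    (hV : ∀ i, (V i : Set ℝ) ⊆ Set.Icc 0 1) {f : Fin n → Fin n → ℝ → ℝ} (hf : IsPrior n V f)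
    {η : ℝ} (hη0 : 0 < η) (hη1 : η ≤ 1) {β' : Fin n → ℝ → ℝ} (hβ' : CPureProfile n B β')
    (i : Fin n) (b v : ℝ) :
    cInterim n (fun i j => smear η (V j) (f i j)) β' i b v =
      interim n V B f (fun i => cellStrat η (extendStrat (β' i))) i b v := by
  set μ : Fin n → Measure ℝ := fun j => if j = i then Measure.dirac 0
    else volume.withDensity (fun x => ENNReal.ofReal (smear η (V j) (f i j) x)) with hμ
  have hp : ∀ j, j ≠ i → ∀ w, 0 ≤ f i j w := fun j hj => (hf i j hj.symm).1
  have : ∀ j, IsFiniteMeasure (μ j) := by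
    intro j
    by_cases hj : j = i
    · simp only [hμ, if_pos hj]
      infer_instance
    · simp only [hμ, if_neg hj]
      exact isFiniteMeasure_smear hη0.le (hp j hj)
  set g : Fin n → ℝ → ℝ := fun j => if j = i then fun _ => b else extendStrat (β' j) with hg
  have hgm : ∀ j, Measurable (g j) := by
    intro j
    by_cases hj : j = i
    · simp only [hg, if_pos hj]
      exact measurable_const
    · simp only [hg, if_neg hj]
      exact (monotone_extendStrat (hβ' j).1).measurable
  have hgT : ∀ j x, g j x ∈ (if j = i then ({b} : Finset ℝ) else B) := by
    intro j x
    by_cases hj : j = i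
    · simp [hg, hj]
    · simp only [hg, if_neg hj]
      exact ((hβ' j).2 _ (Subtype.coe_prop _)).1
  have hae : ∀ᵐ vv ∂Measure.pi μ, ∀ j, j ≠ i → vv j ∈ Set.Icc (0 : ℝ) 1 := by
    rw [ae_all_iff]
    intro j
    by_cases hj : j = i
    · exact Filter.Eventually.of_forall fun _ h => absurd hj h
    · have h1 : ∀ᵐ x ∂μ j, x ∈ Set.Icc (0 : ℝ) 1 := by
        simp only [hμ, if_neg hj]
        exact ae_mem_Icc_smear hη0.le hη1 (hV j) (hp j hj)
      filter_upwards [Measure.tendsto_eval_ae_ae.eventually h1] with vv hvv _ using hvv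
  have hint : cInterim n (fun i j => smear η (V j) (f i j)) β' i b v =
      ∫ vv, exPost n i v (fun j => g j (vv j)) ∂Measure.pi μ := by
    refine integral_congr_ae ?_
    filter_upwards [hae] with vv hvv
    congr 1
    funext j
    by_cases hj : j = i
    · subst hj
      simp [hg]
    · simp only [hg, Function.update_of_ne hj, if_neg hj]
      exact (extendStrat_of_mem (hvv j hj)).symm
  rw [hint, integral_pi_comp_eq_sum μ hgm _ hgT, interim]
  refine Finset.sum_congr rfl fun y hy => ?_
  congr 1
  rw [← Finset.mul_prod_erase _ _ (Finset.mem_univ i)]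
  have hyi : y i = b := by simpa using Fintype.mem_piFinset.1 hy i
  have h1 : (μ i).real (g i ⁻¹' {y i}) = 1 := by
    simp [hμ, hg, hyi]
  rw [h1, one_mul]
  refine Finset.prod_congr rfl fun j hj => ?_
  have hj : j ≠ i := Finset.ne_of_mem_erase hj
  simp only [hμ, hg, if_neg hj]
  exact withDensity_smear_real hη0.le (hp j hj) (monotone_extendStrat (hβ' j).1).measurable _

lemma abs_exPost_sub_le (n : ℕ) (i : Fin n) (v x : ℝ) (bb : Fin n → ℝ) :
    |exPost n i v bb - exPost n i x bb| ≤ |v - x| := by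
  unfold exPost
  split_ifs with h
  · have hmem : i ∈ Finset.univ.filter (fun j : Fin n => ∀ k, bb k ≤ bb j) := by simpa using h
    have hcard : (1 : ℝ) ≤
        ((Finset.univ.filter (fun j : Fin n => ∀ k, bb k ≤ bb j)).card : ℝ) := by
      exact_mod_cast Finset.card_pos.2 ⟨i, hmem⟩
    rw [← sub_div, sub_sub_sub_cancel_right, abs_div, abs_of_pos (zero_lt_one.trans_le hcard)]
    exact div_le_self (abs_nonneg _) hcard
  · simp

lemma sum_prod_beliefs_eq_one {n : ℕ} {V : Fin n → Finset ℝ} {B : Finset ℝ}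
    {f : Fin n → Fin n → ℝ → ℝ} (hf : IsPrior n V f) {β : Fin n → ℝ → ℝ → ℝ}
    (hβ : IsMixedProfile n V B β) (i : Fin n) (b : ℝ) :
    ∑ bb ∈ Fintype.piFinset (fun j : Fin n => if j = i then ({b} : Finset ℝ) else B),
      ∏ j ∈ Finset.univ.erase i, ∑ w ∈ V j, f i j w * β j w (bb j) = 1 := by
  let q : Fin n → ℝ → ℝ := fun j c => if j = i then 1 else ∑ w ∈ V j, f i j w * β j w c
  have hprod : ∀ bb : Fin n → ℝ,
      ∏ j ∈ Finset.univ.erase i, ∑ w ∈ V j, f i j w * β j w (bb j) = ∏ j, q j (bb j) := by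
    intro bb
    rw [← Finset.mul_prod_erase _ _ (Finset.mem_univ i)]
    simp only [q, if_true, one_mul]
    exact Finset.prod_congr rfl fun j hj => by rw [if_neg (Finset.ne_of_mem_erase hj)]
  rw [Finset.sum_congr rfl fun bb _ => hprod bb]
  refine (Finset.prod_univ_sum (fun j => if j = i then {b} else B) q).symm.trans ?_
  refine Finset.prod_eq_one fun j _ => ?_
  by_cases hj : j = i
  · simp [q, hj]
  · simp only [q, if_neg hj]
    rw [Finset.sum_comm, ← (hf i j (Ne.symm hj)).2.2]
    refine Finset.sum_congr rfl fun w hw => ?_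
    rw [← Finset.mul_sum, (hβ j w hw).2, mul_one]

/-- Interim utilities are `1`-Lipschitz in the bidder's own value. -/
lemma abs_interim_sub_le {n : ℕ} {V : Fin n → Finset ℝ} {B : Finset ℝ}
    {f : Fin n → Fin n → ℝ → ℝ} (hf : IsPrior n V f) {β : Fin n → ℝ → ℝ → ℝ}
    (hβ : IsMixedProfile n V B β) (i : Fin n) (b v x : ℝ) :
    |interim n V B f β i b v - interim n V B f β i b x| ≤ |v - x| := by
  have hnn : ∀ bb : Fin n → ℝ,
      0 ≤ ∏ j ∈ Finset.univ.erase i, ∑ w ∈ V j, f i j w * β j w (bb j) := fun bb =>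
    Finset.prod_nonneg fun j hj => Finset.sum_nonneg fun w hw =>
      mul_nonneg ((hf i j (Finset.ne_of_mem_erase hj).symm).1 w) ((hβ j w hw).1 _)
  unfold interim
  rw [← Finset.sum_sub_distrib]
  refine (Finset.abs_sum_le_sum_abs _ _).trans ?_
  rw [← one_mul |v - x|, ← sum_prod_beliefs_eq_one hf hβ i b, Finset.sum_mul]
  refine Finset.sum_le_sum fun bb _ => ?_
  rw [← mul_sub, abs_mul, abs_of_nonneg (hnn bb)]
  exact mul_le_mul_of_nonneg_left (abs_exPost_sub_le n i v x bb) (hnn bb)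

lemma interimMix_le {n : ℕ} {V : Fin n → Finset ℝ} {B : Finset ℝ}
    {f : Fin n → Fin n → ℝ → ℝ} {β : Fin n → ℝ → ℝ → ℝ} {i : Fin n} {γ : ℝ → ℝ}
    (hγ : IsDist B γ) {v c : ℝ} (hc : ∀ b ∈ B, interim n V B f β i b v ≤ c) :
    interimMix n V B f β i γ v ≤ c := by
  rw [← one_mul c, ← hγ.2, Finset.sum_mul]
  exact Finset.sum_le_sum fun b hb => mul_le_mul_of_nonneg_left (hc b hb) (hγ.1 b)

/-- For every `δ ∈ (0,1)` and every DFPA there is a CFPA (same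
bidders, same bidding space, piecewise-constant-density priors) such that every
ε-approximate pure BNE of the CFPA yields an `(ε+δ)`-well-supported, monotone,
non-overbidding MBNE of the DFPA; moreover the CFPA is iid whenever the DFPA is, and
the discrete equilibrium can be chosen symmetric whenever the value spaces coincide
and the continuous equilibrium is symmetric. -/
theorem stmt4 (δ : ℝ) (hδ0 : 0 < δ) (hδ1 : δ < 1)
    (n : ℕ) (hn : 2 ≤ n) (V : Fin n → Finset ℝ) (B : Finset ℝ)
    (hV : ∀ i, ↑(V i) ⊆ Set.Icc (0:ℝ) 1) (hB : ↑B ⊆ Set.Icc (0:ℝ) 1) (h0B : (0:ℝ) ∈ B)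
    (f : Fin n → Fin n → ℝ → ℝ) (hf : IsPrior n V f) :
    ∃ ρ : Fin n → Fin n → ℝ → ℝ,
      (∀ i j : Fin n, i ≠ j → IsPCDensity (ρ i j)) ∧
      ((∃ (V0 : Finset ℝ) (f0 : ℝ → ℝ), (∀ i, V i = V0) ∧
          ∀ i j : Fin n, i ≠ j → f i j = f0) →
        ∃ ρ0 : ℝ → ℝ, ∀ i j : Fin n, i ≠ j → ρ i j = ρ0) ∧
      (∀ ε : ℝ, 0 ≤ ε → ∀ β' : Fin n → ℝ → ℝ,
        CPureProfile n B β' → CPBNE n B ρ β' ε →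
        ∃ β : Fin n → ℝ → ℝ → ℝ,
          IsMixedProfile n V B β ∧
          NonOverbidding n V B β ∧
          (∀ i : Fin n, MonotoneStrat (V i) B (β i)) ∧
          WSMBNE n V B f β (ε + δ) ∧
          (((∀ i i' : Fin n, V i = V i') ∧ (∀ i i' : Fin n, β' i = β' i')) →
            ∀ i i' : Fin n, β i = β i')) := by
  obtain ⟨η, hη0, hηδ, hgap⟩ := exists_pos_lt_gaps (Finset.univ.biUnion V ∪ B) hδ0
  have hη1 : η ≤ 1 := by linarith
  have hVU : ∀ i, ∀ v ∈ V i, v ∈ Finset.univ.biUnion V ∪ B := fun i v hv =>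
    Finset.mem_union_left _ (Finset.mem_biUnion.2 ⟨i, Finset.mem_univ i, hv⟩)
  refine ⟨fun i j => smear η (V j) (f i j), ?_, ?_, ?_⟩
  · intro i j hij
    obtain ⟨h1, _, h3⟩ := hf i j hij
    exact isPCDensity_smear hη0 hη1 (hV j) h1 h3
  · rintro ⟨V0, f0, hV0, hf0⟩
    exact ⟨smear η V0 f0, fun i j hij => by simp only [hV0 j, hf0 i j hij]⟩
  · intro ε _ β' hβ' heq
    have hmeas : ∀ i, Measurable (extendStrat (β' i)) := fun i =>
      (monotone_extendStrat (hβ' i).1).measurable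
    have hmix : IsMixedProfile n V B (fun i => cellStrat η (extendStrat (β' i))) :=
      fun i v _ => isDist_cellStrat hη0 (hmeas i)
        (fun x => ((hβ' i).2 _ (Subtype.coe_prop _)).1) v
    refine ⟨fun i => cellStrat η (extendStrat (β' i)), hmix, ?_, ?_, ?_, ?_⟩
    · intro i v hv b hb hvb
      by_contra hne
      obtain ⟨x, hx, hxb⟩ := exists_mem_cell_of_cellStrat_ne_zero hne
      have hx01 := cell_subset_Icc hη1 (hV i hv) hx
      rw [extendStrat_of_mem hx01] at hxb
      have h1 := ((hβ' i).2 x hx01).2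
      have h2 := abs_le.1 (abs_sub_le_of_mem_cell (hV i hv) hx)
      have h3 := hgap v (hVU i v hv) b (Finset.mem_union_right _ hb) hvb
      linarith [h2.1]
    · intro i v hv v' hv' hvv b _ b' _ hb hb'
      obtain ⟨x, hx, rfl⟩ := exists_mem_cell_of_cellStrat_ne_zero hb.ne'
      obtain ⟨y, hy, rfl⟩ := exists_mem_cell_of_cellStrat_ne_zero hb'.ne'
      refine monotone_extendStrat (hβ' i).1 (hx.2.trans (le_trans ?_ hy.1))
      have h3 := hgap v (hVU i v hv) v' (hVU i v' hv') hvv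
      nlinarith
    · intro i v hv b _ hb γ hγ
      obtain ⟨x, hx, hxb⟩ := exists_mem_cell_of_cellStrat_ne_zero hb.ne'
      have hx01 := cell_subset_Icc hη1 (hV i hv) hx
      rw [extendStrat_of_mem hx01] at hxb
      have hvx := abs_sub_le_of_mem_cell (hV i hv) hx
      have hlip : ∀ c, _ := fun c => abs_le.1 ((abs_interim_sub_le hf hmix i c v x).trans hvx)
      rw [ge_iff_le, sub_le_iff_le_add]
      refine interimMix_le hγ fun c hc => ?_
      have hopt := heq i x hx01 c hc
      rw [cInterim_smear_eq_interim hV hf hη0 hη1 hβ',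
        cInterim_smear_eq_interim hV hf hη0 hη1 hβ', hxb] at hopt
      linarith [(hlip b).1, (hlip c).2]
    · rintro ⟨_, hsym⟩ i i'
      simp only [hsym i i']
end
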